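/- Let Γ be a discrete subgroup of the group of isometries of ℝ² and let L be a 2-contact system of line segments satisfying (S1) (g·l ∈ L for every l ∈ L, g ∈ Γ), (S2) (L has finitely many Γ-orbits), (S4) (for every l ∈ L and x ∈ l, the only g ∈ Γ with g(x) = x is the identity), and (S5) (whenever g ∈ Γ is a non-identity element with g(l) ∩ l ≠ ∅ for some l ∈ L, g is not a translation). Then for every ε > 0 there exist a generic Γ-symmetric contact system L′ (i.e. L′ satisfies (S1)–(S4) with (S3): L′ is generic) and a bijection L → L′, l ↦ l′, such that l ∩ m ≠ ∅ if and only if l′ ∩ m′ ≠ ∅ for all l, m ∈ L, and the Hausdorff distance between l and l′ is less than ε for every l ∈ L. -/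

import Mathlib

noncomputable section

/-- The Euclidean plane. -/
abbrev Pt := EuclideanSpace ℝ (Fin 2)

/-- `S` is a (nondegenerate, closed) line segment in the plane. -/
def IsSeg (S : Set Pt) : Prop := ∃ p q : Pt, p ≠ q ∧ S = segment ℝ p q

/-- `x` is an endpoint of the segment `S`. -/
def IsEndpt (x : Pt) (S : Set Pt) : Prop :=
  ∃ p q : Pt, p ≠ q ∧ S = segment ℝ p q ∧ (x = p ∨ x = q)

/-- `x` is an interior (relative interior) point of the segment `S`. -/
def IsIntPt (x : Pt) (S : Set Pt) : Prop :=
  ∃ p q : Pt, p ≠ q ∧ S = segment ℝ p q ∧ x ∈ openSegment ℝ p q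

/-- A contact system: a collection of (pairwise distinct) segments such that no
point of the plane is an interior point of more than one segment. -/
def IsContactSystem (L : Set (Set Pt)) : Prop :=
  (∀ S ∈ L, IsSeg S) ∧
  ∀ x : Pt, ∀ S ∈ L, ∀ T ∈ L, IsIntPt x S → IsIntPt x T → S = T

/-- A 2-contact system: a contact system such that every point of the plane
belongs to at most two of the segments. -/
def Is2ContactSystem (L : Set (Set Pt)) : Prop :=
  IsContactSystem L ∧
  ∀ x : Pt, ∀ S ∈ L, ∀ T ∈ L, ∀ U ∈ L,
    x ∈ S → x ∈ T → x ∈ U → (S = T ∨ S = U ∨ T = U)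

/-- A generic contact system: a contact system such that moreover no point of
the plane is an endpoint of more than one segment. -/
def IsGenericCS (L : Set (Set Pt)) : Prop :=
  IsContactSystem L ∧
  ∀ x : Pt, ∀ S ∈ L, ∀ T ∈ L, IsEndpt x S → IsEndpt x T → S = T

/-- `x` is a free endpoint of the family `M`: an endpoint of some segment of `M`
that lies in the interior of no segment of `M`. -/
def IsFreeEndpt (x : Pt) (M : Set (Set Pt)) : Prop :=
  (∃ l ∈ M, IsEndpt x l) ∧ ∀ m ∈ M, ¬ IsIntPt x m

/-- The group of isometries of the plane (every isometry of the plane is affine). -/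
abbrev Iso2 := Pt ≃ᵃⁱ[ℝ] Pt

/-- The determinant of the linear part of a plane isometry. -/
def detOf (g : Iso2) : ℝ :=
  LinearMap.det g.linearIsometryEquiv.toLinearEquiv.toLinearMap

/-- A rotation: a non-identity orientation-preserving isometry with a fixed point. -/
def IsRotation (g : Iso2) : Prop := g ≠ 1 ∧ detOf g = 1 ∧ ∃ x : Pt, g x = x

/-- A reflection: an orientation-reversing isometry with a fixed point. -/
def IsReflection (g : Iso2) : Prop := detOf g ≠ 1 ∧ ∃ x : Pt, g x = x

/-- A translation: the map `x ↦ x + v` for some `v ≠ 0`. -/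
def IsTranslation (g : Iso2) : Prop := ∃ v : Pt, v ≠ 0 ∧ ∀ x : Pt, g x = x + v

/-- (S1): the collection `L` of segments is invariant under `Γ`. -/
def SatS1 (Γ : Subgroup Iso2) (L : Set (Set Pt)) : Prop :=
  ∀ l ∈ L, ∀ g ∈ Γ, (⇑g) '' l ∈ L

/-- (S2): `L` has finitely many `Γ`-orbits. -/
def SatS2 (Γ : Subgroup Iso2) (L : Set (Set Pt)) : Prop :=
  ∃ T : Set (Set Pt), T.Finite ∧ T ⊆ L ∧
    ∀ l ∈ L, ∃ t ∈ T, ∃ g ∈ Γ, (⇑g) '' t = l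

/-- (S4): for every `l ∈ L` and every `x ∈ l` the stabiliser of `x` in `Γ` is trivial. -/
def SatS4 (Γ : Subgroup Iso2) (L : Set (Set Pt)) : Prop :=
  ∀ l ∈ L, ∀ x ∈ l, ∀ g ∈ Γ, g x = x → g = 1

/-- A subgroup of the isometry group of the plane is discrete iff (equivalently,
for subgroups of `Isom(ℝ²)`, in the natural topology) each of its orbits is a
discrete subset of the plane. -/
def IsDiscreteSubgrp (Γ : Subgroup Iso2) : Prop :=
  ∀ x : Pt, DiscreteTopology {y : Pt | ∃ g ∈ Γ, g x = y}

/-- A generic `Γ`-symmetric contact system: satisfies (S1)-(S4). -/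
def IsGenSymmCS (Γ : Subgroup Iso2) (L : Set (Set Pt)) : Prop :=
  IsGenericCS L ∧ SatS1 Γ L ∧ SatS2 Γ L ∧ SatS4 Γ L

end

section PlaneGeometry

/-- The signed area of the parallelogram spanned by two vectors of the plane. -/
def det2 (u v : Pt) : ℝ := u 0 * v 1 - u 1 * v 0

lemma det2_add_left (u v w : Pt) : det2 (u + v) w = det2 u w + det2 v w := by
  simp only [det2, PiLp.add_apply]; ring

lemma det2_add_right (u v w : Pt) : det2 u (v + w) = det2 u v + det2 u w := by
  simp only [det2, PiLp.add_apply]; ring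

lemma det2_sub_left (u v w : Pt) : det2 (u - v) w = det2 u w - det2 v w := by
  simp only [det2, PiLp.sub_apply]; ring

lemma det2_sub_right (u v w : Pt) : det2 u (v - w) = det2 u v - det2 u w := by
  simp only [det2, PiLp.sub_apply]; ring

lemma det2_smul_left (k : ℝ) (u v : Pt) : det2 (k • u) v = k * det2 u v := by
  simp only [det2, PiLp.smul_apply, smul_eq_mul]; ring

lemma det2_smul_right (k : ℝ) (u v : Pt) : det2 u (k • v) = k * det2 u v := by
  simp only [det2, PiLp.smul_apply, smul_eq_mul]; ring

lemma det2_self (u : Pt) : det2 u u = 0 := by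
  simp only [det2]; ring

lemma det2_neg_swap (u v : Pt) : -det2 u v = det2 v u := by
  simp only [det2]; ring

lemma continuous_det2 : Continuous fun z : Pt × Pt => det2 z.1 z.2 := by
  unfold det2; fun_prop

lemma exists_eq_smul_of_det2_eq_zero {u v : Pt} (hu : u ≠ 0) (h : det2 u v = 0) :
    ∃ k : ℝ, v = k • u := by
  have hn : u 0 ^ 2 + u 1 ^ 2 ≠ 0 := by
    intro h0
    apply hu
    ext i
    fin_cases i
    · simp; nlinarith [sq_nonneg (u 0), sq_nonneg (u 1)]
    · simp; nlinarith [sq_nonneg (u 0), sq_nonneg (u 1)]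
  unfold det2 at h
  refine ⟨(u 0 * v 0 + u 1 * v 1) / (u 0 ^ 2 + u 1 ^ 2), ?_⟩
  ext i
  fin_cases i
  · simp only [Fin.zero_eta, PiLp.smul_apply, smul_eq_mul]
    field_simp
    linear_combination (-u 1) * h
  · simp only [Fin.mk_one, PiLp.smul_apply, smul_eq_mul]
    field_simp
    linear_combination (u 0) * h

lemma mem_openSegment_iff_exists {x p q : Pt} :
    x ∈ openSegment ℝ p q ↔ ∃ s : ℝ, 0 < s ∧ s < 1 ∧ x = p + s • (q - p) := by
  rw [openSegment_eq_image']
  constructor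
  · rintro ⟨s, ⟨h0, h1⟩, rfl⟩
    exact ⟨s, h0, h1, rfl⟩
  · rintro ⟨s, h0, h1, rfl⟩
    exact ⟨s, ⟨h0, h1⟩, rfl⟩

lemma mem_segment_iff_exists {x p q : Pt} :
    x ∈ segment ℝ p q ↔ ∃ s : ℝ, 0 ≤ s ∧ s ≤ 1 ∧ x = p + s • (q - p) := by
  rw [segment_eq_image']
  constructor
  · rintro ⟨s, ⟨h0, h1⟩, rfl⟩
    exact ⟨s, h0, h1, rfl⟩
  · rintro ⟨s, h0, h1, rfl⟩
    exact ⟨s, ⟨h0, h1⟩, rfl⟩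

lemma left_notMem_openSegment {p q u v : Pt} (hu : u ∈ segment ℝ p q)
    (hv : v ∈ segment ℝ p q) (huv : u ≠ v) : p ∉ openSegment ℝ u v := by
  intro h
  obtain ⟨a, ha, -, rfl⟩ := mem_segment_iff_exists.1 hu
  obtain ⟨b, hb, -, rfl⟩ := mem_segment_iff_exists.1 hv
  obtain ⟨s, h0, h1, h⟩ := mem_openSegment_iff_exists.1 h
  have h2 : ((1 - s) * a + s * b) • (q - p) = 0 := by
    have : p = p + ((1 - s) * a + s * b) • (q - p) := by
      conv_lhs => rw [h]
      module
    simpa using this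
  rcases smul_eq_zero.1 h2 with h2 | h2
  · have hsb : 0 ≤ s * b := by positivity
    have hsa : 0 ≤ (1 - s) * a := mul_nonneg (by linarith) ha
    have ha0 : a = 0 := by
      have : (1 - s) * a = 0 := by linarith
      rcases mul_eq_zero.1 this with h3 | h3 <;> linarith
    have hb0 : b = 0 := by
      have : s * b = 0 := by linarith
      rcases mul_eq_zero.1 this with h3 | h3 <;> linarith
    exact huv (by rw [ha0, hb0])
  · exact huv (by rw [h2]; simp)

lemma left_eq_of_segment_eq {p q p' q' : Pt} (h' : p' ≠ q')
    (h : segment ℝ p q = segment ℝ p' q') : p = p' ∨ p = q' := by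
  have hp : p ∈ segment ℝ p' q' := h ▸ left_mem_segment ℝ p q
  rw [← insert_endpoints_openSegment] at hp
  rcases hp with hp | hp | hp
  · exact Or.inl hp
  · exact Or.inr hp
  · exact absurd hp (left_notMem_openSegment (h ▸ left_mem_segment ℝ p' q')
      (h ▸ right_mem_segment ℝ p' q') h')

lemma isEndpt_segment_iff {x p q : Pt} (hpq : p ≠ q) :
    IsEndpt x (segment ℝ p q) ↔ x = p ∨ x = q := by
  constructor
  · rintro ⟨p', q', h', h, rfl | rfl⟩
    · exact left_eq_of_segment_eq hpq h.symm
    · exact left_eq_of_segment_eq hpq (by rw [segment_symm, ← h])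
  · intro h
    exact ⟨p, q, hpq, rfl, h⟩

lemma mem_openSegment_iff_of_ne {x p q : Pt} (hpq : p ≠ q) :
    x ∈ openSegment ℝ p q ↔ x ∈ segment ℝ p q ∧ x ≠ p ∧ x ≠ q := by
  constructor
  · intro h
    refine ⟨openSegment_subset_segment ℝ p q h, ?_, ?_⟩
    · rintro rfl
      exact hpq (left_mem_openSegment_iff.1 h)
    · rintro rfl
      exact hpq (right_mem_openSegment_iff.1 h)
  · rintro ⟨h, h1, h2⟩
    exact mem_openSegment_of_ne_left_right h1.symm h2.symm h

lemma isIntPt_segment_iff {x p q : Pt} (hpq : p ≠ q) :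
    IsIntPt x (segment ℝ p q) ↔ x ∈ openSegment ℝ p q := by
  constructor
  · rintro ⟨p', q', h', h, hx⟩
    rw [mem_openSegment_iff_of_ne h', ← h] at hx
    rw [mem_openSegment_iff_of_ne hpq]
    refine ⟨hx.1, ?_, ?_⟩
    · rintro rfl
      rcases left_eq_of_segment_eq h' h with h3 | h3
      exacts [hx.2.1 h3, hx.2.2 h3]
    · rintro rfl
      rcases left_eq_of_segment_eq h' ((segment_symm ℝ x p).trans h) with h3 | h3
      exacts [hx.2.1 h3, hx.2.2 h3]
  · intro h
    exact ⟨p, q, hpq, rfl, h⟩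

/-- Two segments are in generic position if they have no common interior point and no
common endpoint. -/
def GenericPair (S T : Set Pt) : Prop :=
  (∀ x, IsIntPt x S → IsIntPt x T → False) ∧ ∀ x, IsEndpt x S → IsEndpt x T → False

lemma GenericPair.symm {S T : Set Pt} (h : GenericPair S T) : GenericPair T S :=
  ⟨fun x h1 h2 => h.1 x h2 h1, fun x h1 h2 => h.2 x h2 h1⟩

lemma eq_left_of_det2_ne_zero {a b c d x : Pt} (ha : a ∈ segment ℝ c d)
    (hc : det2 (b - a) (d - c) ≠ 0) (h1 : x ∈ segment ℝ a b) (h2 : x ∈ segment ℝ c d) :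
    x = a := by
  obtain ⟨r, -, -, hr⟩ := mem_segment_iff_exists.1 ha
  obtain ⟨s, -, -, hs⟩ := mem_segment_iff_exists.1 h1
  obtain ⟨u, -, -, hu⟩ := mem_segment_iff_exists.1 h2
  have h3 : s • (b - a) = (u - r) • (d - c) := by
    have e1 : s • (b - a) = x - a := by rw [hs]; abel
    have e2 : x - a = (u - r) • (d - c) := by rw [hu, hr]; module
    rw [e1, e2]
  have h4 : s * det2 (b - a) (d - c) = 0 := by
    rw [← det2_smul_left, h3, det2_smul_left, det2_self, mul_zero]
  have h5 : s = 0 := (mul_eq_zero.1 h4).resolve_right hc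
  rw [hs, h5]; simp

lemma genericPair_of_mem_openSegment {a b c d : Pt} (ha : a ∈ openSegment ℝ c d)
    (hc : det2 (b - a) (d - c) ≠ 0) : GenericPair (segment ℝ a b) (segment ℝ c d) := by
  have hab : a ≠ b := by
    rintro rfl
    simp [det2] at hc
  have hcd : c ≠ d := by
    rintro rfl
    simp [det2] at hc
  have ha' := openSegment_subset_segment ℝ c d ha
  refine ⟨fun x h1 h2 => ?_, fun x h1 h2 => ?_⟩
  · rw [isIntPt_segment_iff hab] at h1
    rw [isIntPt_segment_iff hcd] at h2
    have hx := eq_left_of_det2_ne_zero ha' hc (openSegment_subset_segment ℝ a b h1)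
      (openSegment_subset_segment ℝ c d h2)
    subst hx
    exact hab (left_mem_openSegment_iff.1 h1)
  · rw [isEndpt_segment_iff hab] at h1
    rw [isEndpt_segment_iff hcd] at h2
    have h1' : x ∈ segment ℝ a b := by
      rcases h1 with rfl | rfl
      exacts [left_mem_segment ℝ _ _, right_mem_segment ℝ _ _]
    have h2' : x ∈ segment ℝ c d := by
      rcases h2 with rfl | rfl
      exacts [left_mem_segment ℝ _ _, right_mem_segment ℝ _ _]
    have hx := eq_left_of_det2_ne_zero ha' hc h1' h2'
    subst hx
    have := (mem_openSegment_iff_of_ne hcd).1 ha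
    rcases h2 with h2 | h2
    exacts [this.2.1 h2, this.2.2 h2]

lemma Iso2.image_segment (g : Iso2) (a b : Pt) :
    g '' segment ℝ a b = segment ℝ (g a) (g b) :=
  _root_.image_segment ℝ g.toAffineEquiv.toAffineMap a b

lemma Iso2.image_openSegment (g : Iso2) (a b : Pt) :
    g '' openSegment ℝ a b = openSegment ℝ (g a) (g b) :=
  _root_.image_openSegment ℝ g.toAffineEquiv.toAffineMap a b

lemma Iso2.map_add (g : Iso2) (x v : Pt) : g (x + v) = g x + g.linearIsometryEquiv v := by
  have := g.map_vadd x v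
  rw [vadd_eq_add, vadd_eq_add] at this
  rw [add_comm x v, this, add_comm]

lemma Iso2.linear_sub (g : Iso2) (x y : Pt) :
    g.linearIsometryEquiv (x - y) = g x - g y := by
  have := Iso2.map_add g y (x - y)
  rw [add_sub_cancel] at this
  rw [this]; abel

lemma Iso2.image_mul (g h : Iso2) (S : Set Pt) : (g * h) '' S = g '' (h '' S) := by
  rw [AffineIsometryEquiv.coe_mul, Set.image_comp]

lemma Iso2.image_inv_image (g : Iso2) (S : Set Pt) : (g⁻¹ : Iso2) '' (g '' S) = S := by
  rw [← Iso2.image_mul, inv_mul_cancel, AffineIsometryEquiv.coe_one, Set.image_id]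

lemma IsIntPt.image {x : Pt} {S : Set Pt} (g : Iso2) (h : IsIntPt x S) :
    IsIntPt (g x) (g '' S) := by
  obtain ⟨p, q, hpq, rfl, hx⟩ := h
  refine ⟨g p, g q, g.injective.ne hpq, Iso2.image_segment g p q, ?_⟩
  rw [← Iso2.image_openSegment]
  exact Set.mem_image_of_mem g hx

lemma IsEndpt.image {x : Pt} {S : Set Pt} (g : Iso2) (h : IsEndpt x S) :
    IsEndpt (g x) (g '' S) := by
  obtain ⟨p, q, hpq, rfl, hx⟩ := h
  refine ⟨g p, g q, g.injective.ne hpq, Iso2.image_segment g p q, ?_⟩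
  rcases hx with rfl | rfl
  exacts [Or.inl rfl, Or.inr rfl]

lemma GenericPair.image {S T : Set Pt} (g : Iso2) (h : GenericPair S T) :
    GenericPair (g '' S) (g '' T) := by
  refine ⟨fun x h1 h2 => ?_, fun x h1 h2 => ?_⟩
  · have h1 := h1.image g⁻¹
    have h2 := h2.image g⁻¹
    rw [Iso2.image_inv_image] at h1 h2
    exact h.1 _ h1 h2
  · have h1 := h1.image g⁻¹
    have h2 := h2.image g⁻¹
    rw [Iso2.image_inv_image] at h1 h2
    exact h.2 _ h1 h2

lemma exists_mem_segment_dist_lt {a b a' b' x : Pt} {r : ℝ} (ha : dist a a' < r)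
    (hb : dist b b' < r) (hx : x ∈ segment ℝ a b) : ∃ y ∈ segment ℝ a' b', dist x y < r := by
  obtain ⟨s, u, hs, hu, hsu, rfl⟩ := hx
  refine ⟨s • a' + u • b', ⟨s, u, hs, hu, hsu, rfl⟩, ?_⟩
  have ha' : a - a' ∈ Metric.ball (0 : Pt) r := by
    rw [mem_ball_zero_iff, ← dist_eq_norm]; exact ha
  have hb' : b - b' ∈ Metric.ball (0 : Pt) r := by
    rw [mem_ball_zero_iff, ← dist_eq_norm]; exact hb
  have hball := convex_ball (0 : Pt) r ha' hb' hs hu hsu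
  rw [mem_ball_zero_iff] at hball
  have hsub : s • a + u • b - (s • a' + u • b') = s • (a - a') + u • (b - b') := by module
  rwa [dist_eq_norm, hsub]

/-- A segment ending in an interior point of another segment without common interior
points is not parallel to it. -/
lemma det2_ne_zero_of_mem_openSegment {x y p q : Pt} (hpq : p ≠ q)
    (hx : x ∈ openSegment ℝ p q)
    (h : ∀ u, u ∈ openSegment ℝ x y → u ∈ openSegment ℝ p q → False) :
    det2 (x - y) (q - p) ≠ 0 := by
  intro h0
  obtain ⟨s, hs0, hs1, hs⟩ := mem_openSegment_iff_exists.1 hx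
  have hqp : q - p ≠ 0 := sub_ne_zero.2 hpq.symm
  rw [← det2_neg_swap, neg_eq_zero] at h0
  obtain ⟨k, hk⟩ := exists_eq_smul_of_det2_eq_zero hqp h0
  obtain ⟨m, hm0, hms, hms'⟩ : ∃ m : ℝ, 0 < m ∧ m < s ∧ m < 1 - s := by
    obtain ⟨m, h1, h2⟩ := exists_between (lt_min hs0 (sub_pos.2 hs1))
    exact ⟨m, h1, lt_of_lt_of_le h2 (min_le_left _ _), lt_of_lt_of_le h2 (min_le_right _ _)⟩
  have hk0 : 0 < 1 + |k| := by positivity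
  set τ := m / (1 + |k|) with hτ
  have hτ0 : 0 < τ := by positivity
  have hτm : τ * (1 + |k|) = m := by rw [hτ]; field_simp
  have hτk : |τ * k| < m := by
    rw [abs_mul, abs_of_pos hτ0]; nlinarith
  have hτ1 : τ < 1 := by nlinarith [mul_nonneg hτ0.le (abs_nonneg k)]
  rw [abs_lt] at hτk
  refine h (x + τ • (y - x)) (mem_openSegment_iff_exists.2 ⟨τ, hτ0, hτ1, rfl⟩)
    (mem_openSegment_iff_exists.2 ⟨s - τ * k, by linarith, by linarith, ?_⟩)
  have : y - x = -(k • (q - p)) := by rw [← hk]; abel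
  rw [this, hs]
  module

/-- Two parallel segments with a common endpoint and without common interior points point
in opposite directions. -/
lemma exists_pos_smul_of_det2_eq_zero {x y z : Pt} (hxy : x ≠ y) (hxz : x ≠ z)
    (h0 : det2 (x - y) (z - x) = 0)
    (h : ∀ u, u ∈ openSegment ℝ x y → u ∈ openSegment ℝ x z → False) :
    ∃ k : ℝ, 0 < k ∧ z - x = k • (x - y) := by
  obtain ⟨k, hk⟩ := exists_eq_smul_of_det2_eq_zero (sub_ne_zero.2 hxy) h0
  refine ⟨k, ?_, hk⟩
  by_contra hk0
  have hk1 : k ≠ 0 := by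
    rintro rfl
    rw [zero_smul] at hk
    exact hxz (sub_eq_zero.1 hk).symm
  have hk2 : 0 < -k := by
    rcases lt_or_gt_of_ne hk1 with h1 | h1 <;> linarith
  obtain ⟨τ, hτ0, hτ⟩ := exists_between (lt_min one_pos hk2)
  have hτ1 := lt_of_lt_of_le hτ (min_le_left _ _)
  have hτ2 := lt_of_lt_of_le hτ (min_le_right _ _)
  refine h (x + τ • (y - x)) (mem_openSegment_iff_exists.2 ⟨τ, hτ0, hτ1, rfl⟩)
    (mem_openSegment_iff_exists.2 ⟨τ / (-k), by positivity, by rwa [div_lt_one hk2], ?_⟩)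
  have : τ / (-k) * k = -τ := by field_simp
  rw [hk, smul_smul, this]
  module

end PlaneGeometry

section Frames

/-- The `i`-th segment of a family of segments given by their pairs of endpoints. -/
def seg {ι : Type*} (e : ι → Bool → Pt) (i : ι) : Set Pt := segment ℝ (e i false) (e i true)

/-- The relative interior of the `i`-th segment. -/
def openSeg {ι : Type*} (e : ι → Bool → Pt) (i : ι) : Set Pt :=
  openSegment ℝ (e i false) (e i true)

lemma seg_eq {ι : Type*} (e : ι → Bool → Pt) (i : ι) (b : Bool) :
    seg e i = segment ℝ (e i b) (e i !b) := by
  cases b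
  · rfl
  · exact segment_symm ℝ _ _

lemma openSeg_eq {ι : Type*} (e : ι → Bool → Pt) (i : ι) (b : Bool) :
    openSeg e i = openSegment ℝ (e i b) (e i !b) := by
  cases b
  · rfl
  · exact openSegment_symm ℝ _ _

lemma mem_seg {ι : Type*} (e : ι → Bool → Pt) (i : ι) (b : Bool) : e i b ∈ seg e i := by
  rw [seg_eq e i b]
  exact left_mem_segment ℝ _ _

lemma openSeg_subset_seg {ι : Type*} (e : ι → Bool → Pt) (i : ι) : openSeg e i ⊆ seg e i :=
  openSegment_subset_segment ℝ _ _

/-- A finite family of segments, given by their endpoints, whose translates under the discrete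
group `Γ` form a 2-contact system without repetitions on which `Γ` acts freely, and in which no
segment meets its image under a translation in `Γ`. -/
structure IsFrame (Γ : Subgroup Iso2) {n : ℕ} (e : Fin n → Bool → Pt) : Prop where
  ne : ∀ i, e i false ≠ e i true
  disc : IsDiscreteSubgrp Γ
  interior : ∀ i j, ∀ g ∈ Γ, ∀ h ∈ Γ, ∀ x, x ∈ g '' openSeg e i → x ∈ h '' openSeg e j →
    i = j ∧ g = h
  two : ∀ i j k, ∀ g ∈ Γ, ∀ h ∈ Γ, ∀ u ∈ Γ, ∀ x, x ∈ g '' seg e i → x ∈ h '' seg e j →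
    x ∈ u '' seg e k → (i = j ∧ g = h) ∨ (i = k ∧ g = u) ∨ (j = k ∧ h = u)
  free : ∀ i, ∀ x ∈ seg e i, ∀ g ∈ Γ, g x = x → g = 1
  transl : ∀ i, ∀ g ∈ Γ, g ≠ 1 → (g '' seg e i ∩ seg e i).Nonempty → ¬ IsTranslation g

variable {Γ : Subgroup Iso2} {n : ℕ} {e : Fin n → Bool → Pt}

lemma IsFrame.ne_not (F : IsFrame Γ e) (i : Fin n) (b : Bool) : e i b ≠ e i !b := by
  cases b
  · exact F.ne i
  · exact (F.ne i).symm

lemma IsFrame.eq_of_apply_eq (F : IsFrame Γ e) {i : Fin n} {x : Pt} (hx : x ∈ seg e i)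
    {g h : Iso2} (hg : g ∈ Γ) (hh : h ∈ Γ) (hgh : g x = h x) : g = h := by
  have : h⁻¹ * g = 1 := by
    refine F.free i x hx _ (Γ.mul_mem (Γ.inv_mem hh) hg) ?_
    rw [AffineIsometryEquiv.coe_mul, Function.comp_apply, hgh, AffineIsometryEquiv.coe_inv,
      AffineIsometryEquiv.symm_apply_apply]
  rw [inv_mul_eq_one] at this
  exact this.symm

/-- Only finitely many elements of a discrete group move a point with trivial stabilizer into a
given ball. -/
lemma finite_setOf_dist_apply_le (hdisc : IsDiscreteSubgrp Γ) {x : Pt}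
    (hx : ∀ g ∈ Γ, g x = x → g = 1) (y : Pt) (C : ℝ) :
    {g : Iso2 | g ∈ Γ ∧ dist y (g x) ≤ C}.Finite := by
  have h1 := hdisc x
  obtain ⟨δ, hδ, hsep⟩ : ∃ δ > 0, ∀ g ∈ Γ, dist (g x) x < δ → g x = x := by
    have hxm : x ∈ {y : Pt | ∃ g ∈ Γ, g x = y} := ⟨1, Γ.one_mem, rfl⟩
    have := isOpen_discrete ({⟨x, hxm⟩} : Set {y : Pt | ∃ g ∈ Γ, g x = y})
    rw [Metric.isOpen_iff] at this
    obtain ⟨δ, hδ, hb⟩ := this ⟨x, hxm⟩ rfl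
    refine ⟨δ, hδ, fun g hg hgx => ?_⟩
    have h2 : (⟨g x, ⟨g, hg, rfl⟩⟩ : {y : Pt | ∃ g ∈ Γ, g x = y}) ∈
        Metric.ball (⟨x, hxm⟩ : {y : Pt | ∃ g ∈ Γ, g x = y}) δ := hgx
    exact congrArg Subtype.val (hb h2)
  obtain ⟨t, ht, hcov⟩ := Metric.totallyBounded_iff.1
    (isCompact_closedBall y C).totallyBounded (δ / 2) (half_pos hδ)
  have hch : ∀ g : Iso2, ∃ c, (g ∈ Γ ∧ dist y (g x) ≤ C) → c ∈ t ∧ dist (g x) c < δ / 2 := by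
    intro g
    by_cases hg : g ∈ Γ ∧ dist y (g x) ≤ C
    · have : g x ∈ Metric.closedBall y C := by
        rw [Metric.mem_closedBall, dist_comm]; exact hg.2
      obtain ⟨c, hc, hc'⟩ := Set.mem_iUnion₂.1 (hcov this)
      exact ⟨c, fun _ => ⟨hc, hc'⟩⟩
    · exact ⟨x, fun h => absurd h hg⟩
  choose c hc using hch
  refine Set.Finite.of_finite_image (f := c) (ht.subset ?_) ?_
  · rintro _ ⟨g, hg, rfl⟩
    exact (hc g hg).1
  · intro g hg h hh hgh
    have hd : dist (g x) (h x) < δ := by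
      have h2 := (hc g hg).2
      have h3 := (hc h hh).2
      rw [← hgh] at h3
      linarith [dist_triangle_right (g x) (h x) (c g)]
    have hd' : dist ((h⁻¹ * g) x) x < δ := by
      rw [← h.dist_map, AffineIsometryEquiv.coe_mul, Function.comp_apply,
        AffineIsometryEquiv.coe_inv, AffineIsometryEquiv.apply_symm_apply]
      exact hd
    have hm : h⁻¹ * g ∈ Γ := Γ.mul_mem (Γ.inv_mem hh.1) hg.1
    have := hx _ hm (hsep _ hm hd')
    rw [inv_mul_eq_one] at this
    exact this.symm

lemma IsFrame.finite_near (F : IsFrame Γ e) (i j : Fin n) :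
    {g : Iso2 | g ∈ Γ ∧ ∃ x ∈ seg e i, ∃ y ∈ g '' seg e j, dist x y ≤ 1}.Finite := by
  refine (finite_setOf_dist_apply_le F.disc (F.free j (e j false) (mem_seg e j false))
    (e i false) (dist (e i false) (e i true) + 1 + dist (e j false) (e j true))).subset ?_
  rintro g ⟨hg, x, hx, _, ⟨y, hy, rfl⟩, hxy⟩
  refine ⟨hg, ?_⟩
  have h1 : dist (e i false) x ≤ dist (e i false) (e i true) := by
    have := dist_add_dist_of_mem_segment hx
    linarith [dist_nonneg (x := x) (y := e i true)]
  have h2 : dist (g y) (g (e j false)) ≤ dist (e j false) (e j true) := by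
    rw [g.dist_map, dist_comm]
    have := dist_add_dist_of_mem_segment hy
    linarith [dist_nonneg (x := y) (y := e j true)]
  linarith [dist_triangle4 (e i false) x (g y) (g (e j false))]

lemma exists_isFrame (hdisc : IsDiscreteSubgrp Γ) {L : Set (Set Pt)} (hL : Is2ContactSystem L)
    (hS1 : SatS1 Γ L) (hS2 : SatS2 Γ L) (hS4 : SatS4 Γ L)
    (hS5 : ∀ g ∈ Γ, g ≠ 1 → (∃ l ∈ L, ((⇑g) '' l ∩ l).Nonempty) → ¬ IsTranslation g) :
    ∃ (n : ℕ) (e : Fin n → Bool → Pt), IsFrame Γ e ∧ (∀ i, ∀ g ∈ Γ, g '' seg e i ∈ L) ∧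
      (∀ l ∈ L, ∃ i, ∃ g ∈ Γ, g '' seg e i = l) ∧
      ∀ i j, ∀ g ∈ Γ, ∀ h ∈ Γ, g '' seg e i = h '' seg e j → i = j ∧ g = h := by
  let r : Setoid L :=
    { r := fun a b => ∃ g ∈ Γ, g '' (a : Set Pt) = b
      iseqv :=
        { refl := fun a => ⟨1, Γ.one_mem, by simp⟩
          symm := by
            rintro a b ⟨g, hg, h⟩
            exact ⟨g⁻¹, Γ.inv_mem hg, by rw [← h, Iso2.image_inv_image]⟩
          trans := by
            rintro a b c ⟨g, hg, h⟩ ⟨g', hg', h'⟩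
            exact ⟨g' * g, Γ.mul_mem hg' hg, by rw [Iso2.image_mul, h, h']⟩ } }
  obtain ⟨T, hTfin, hTL, hT⟩ := hS2
  have : Finite T := hTfin
  have : Finite (Quotient r) := by
    refine Finite.of_surjective (fun t : T => (Quotient.mk r ⟨t, hTL t.2⟩)) fun q => ?_
    obtain ⟨l, rfl⟩ := Quotient.exists_rep q
    obtain ⟨t, ht, g, hg, h⟩ := hT l l.2
    exact ⟨⟨t, ht⟩, Quotient.sound ⟨g, hg, h⟩⟩
  obtain ⟨n, ⟨E⟩⟩ := Finite.exists_equiv_fin (Quotient r)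
  have hseg : ∀ i : Fin n, ∃ f : Bool → Pt, f false ≠ f true ∧
      ((E.symm i).out : Set Pt) = segment ℝ (f false) (f true) := by
    intro i
    obtain ⟨p, q, hpq, h⟩ := hL.1.1 _ (E.symm i).out.2
    exact ⟨fun b => bif b then q else p, hpq, h⟩
  choose e hne he using hseg
  have hmem : ∀ i, ∀ g ∈ Γ, g '' seg e i ∈ L := by
    intro i g hg
    have := hS1 _ (E.symm i).out.2 g hg
    rwa [he] at this
  have hfree : ∀ i, ∀ x ∈ seg e i, ∀ g ∈ Γ, g x = x → g = 1 := by
    intro i x hx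
    have := hS4 _ (E.symm i).out.2 x
    rw [he] at this
    exact this hx
  have hinj : ∀ i j, ∀ g ∈ Γ, ∀ h ∈ Γ, g '' seg e i = h '' seg e j → i = j ∧ g = h := by
    intro i j g hg h hh hgh
    have h1 : (h⁻¹ * g) '' seg e i = seg e j := by
      rw [Iso2.image_mul, hgh, Iso2.image_inv_image]
    have hm : h⁻¹ * g ∈ Γ := Γ.mul_mem (Γ.inv_mem hh) hg
    have hij : i = j := by
      apply E.symm.injective
      rw [← Quotient.out_eq (E.symm i), ← Quotient.out_eq (E.symm j)]
      refine Quotient.sound ⟨h⁻¹ * g, hm, ?_⟩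
      rw [he, he]
      exact h1
    subst hij
    refine ⟨rfl, ?_⟩
    have hmid : (h⁻¹ * g) (midpoint ℝ (e i false) (e i true)) =
        midpoint ℝ (e i false) (e i true) := by
      unfold seg at h1
      rw [Iso2.image_segment] at h1
      have h2 := (h⁻¹ * g).toAffineEquiv.toAffineMap.map_midpoint (e i false) (e i true)
      have h3 : (h⁻¹ * g) (midpoint ℝ (e i false) (e i true)) =
        midpoint ℝ ((h⁻¹ * g) (e i false)) ((h⁻¹ * g) (e i true)) := h2
      rw [h3]
      have hne' := (h⁻¹ * g).injective.ne (hne i)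
      rcases left_eq_of_segment_eq (hne i) h1 with h4 | h4 <;>
      rcases left_eq_of_segment_eq (hne i) ((segment_symm ℝ _ _).trans h1) with h5 | h5
      · exact absurd (h4.trans h5.symm) hne'
      · rw [h4, h5]
      · rw [h4, h5, midpoint_comm]
      · exact absurd (h4.trans h5.symm) hne'
    have := hfree i _ (midpoint_mem_segment _ _) _ hm hmid
    rw [inv_mul_eq_one] at this
    exact this.symm
  refine ⟨n, e, ⟨hne, hdisc, ?_, ?_, hfree, ?_⟩, hmem, ?_, hinj⟩
  · intro i j g hg h hh x hx hx'
    refine hinj i j g hg h hh (hL.1.2 x _ (hmem i g hg) _ (hmem j h hh) ?_ ?_)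
    · obtain ⟨y, hy, rfl⟩ := hx
      exact IsIntPt.image g ⟨_, _, hne i, rfl, hy⟩
    · obtain ⟨y, hy, rfl⟩ := hx'
      exact IsIntPt.image h ⟨_, _, hne j, rfl, hy⟩
  · intro i j k g hg h hh u hu x hx hx' hx''
    rcases hL.2 x _ (hmem i g hg) _ (hmem j h hh) _ (hmem k u hu) hx hx' hx'' with H | H | H
    · exact Or.inl (hinj _ _ _ hg _ hh H)
    · exact Or.inr (Or.inl (hinj _ _ _ hg _ hu H))
    · exact Or.inr (Or.inr (hinj _ _ _ hh _ hu H))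
  · intro i g hg hg1 hne
    refine hS5 g hg hg1 ⟨seg e i, ?_, hne⟩
    have := hmem i 1 Γ.one_mem
    rwa [AffineIsometryEquiv.coe_one, Set.image_id] at this
  · intro l hl
    obtain ⟨g, hg, h⟩ : r.r (E.symm (E (Quotient.mk r ⟨l, hl⟩))).out ⟨l, hl⟩ := by
      apply Quotient.exact
      rw [Quotient.out_eq, Equiv.symm_apply_apply]
    refine ⟨E (Quotient.mk r ⟨l, hl⟩), g, hg, ?_⟩
    rw [he] at h
    exact h

end Frames

section EquivariantFields

/-- The space of `Γ`-equivariant vector fields on the plane. -/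
def equivariantFields (Γ : Subgroup Iso2) : Submodule ℝ (Pt → Pt) where
  carrier := {w | ∀ g ∈ Γ, ∀ x, w (g x) = g.linearIsometryEquiv (w x)}
  add_mem' := by
    intro a b ha hb g hg x
    rw [Pi.add_apply, Pi.add_apply, ha g hg, hb g hg, map_add]
  zero_mem' := by
    intro g hg x
    rw [Pi.zero_apply, Pi.zero_apply, map_zero]
  smul_mem' := by
    intro c a ha g hg x
    rw [Pi.smul_apply, Pi.smul_apply, ha g hg, map_smul]

/-- The first-order change of the signed area of the triangle `y`, `x`, `z` when its vertices
move along a vector field. -/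
def bend (y x z : Pt) : Module.Dual ℝ (Pt → Pt) where
  toFun w := det2 (w x - w y) (z - x) + det2 (x - y) (w z - w x)
  map_add' := by
    intro a b
    simp only [Pi.add_apply, det2_add_left, det2_add_right, det2_sub_left, det2_sub_right]
    ring
  map_smul' := by
    intro c a
    simp only [Pi.smul_apply, ← smul_sub, det2_smul_left, det2_smul_right, RingHom.id_apply,
      smul_eq_mul]
    ring

lemma bend_apply (y x z : Pt) (w : Pt → Pt) :
    bend y x z w = det2 (w x - w y) (z - x) + det2 (x - y) (w z - w x) := rfl

/-- The quarter turn of a vector. -/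
def perp (d : Pt) : Pt := !₂[-d 1, d 0]

lemma inner_perp (d v : Pt) : inner ℝ (perp d) v = det2 d v := by
  simp [perp, det2, PiLp.inner_apply, Fin.sum_univ_two]
  ring

lemma inner_self_perp (d : Pt) : inner ℝ d (perp d) = 0 := by
  rw [real_inner_comm, inner_perp]
  unfold det2
  ring

lemma det2_perp_sub_nonneg {d v : Pt} (hv : ‖v‖ ≤ ‖perp d‖) : 0 ≤ det2 d (perp d - v) := by
  rw [← inner_perp, inner_sub_right, real_inner_self_eq_norm_sq]
  nlinarith [real_inner_le_norm (perp d) v, norm_nonneg (perp d)]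

lemma eq_perp_of_det2_sub_eq_zero {d v : Pt} (hv : ‖v‖ ≤ ‖perp d‖)
    (h : det2 d (perp d - v) = 0) : v = perp d := by
  rw [← inner_perp, inner_sub_right, real_inner_self_eq_norm_sq] at h
  have h1 := norm_sub_sq_real (perp d) v
  have h2 : ‖perp d - v‖ ^ 2 ≤ 0 := by
    nlinarith [norm_nonneg (perp d), norm_nonneg v]
  have h3 : ‖perp d - v‖ = 0 := by
    nlinarith [norm_nonneg (perp d - v)]
  exact (sub_eq_zero.1 (norm_eq_zero.1 h3)).symm

/-- A linear isometry of the plane that fixes the normal of a line fixes or reverses the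
direction of the line. -/
lemma map_eq_or_eq_neg_of_map_perp (f : Pt ≃ₗᵢ[ℝ] Pt) {d : Pt} (hd : d ≠ 0)
    (h : f (perp d) = perp d) : f d = d ∨ f d = -d := by
  have h1 : det2 d (f d) = 0 := by
    rw [← inner_perp, ← h, f.inner_map_map, real_inner_comm, inner_self_perp]
  obtain ⟨k, hk⟩ := exists_eq_smul_of_det2_eq_zero hd h1
  have h2 : |k| = 1 := by
    have := f.norm_map d
    rw [hk, norm_smul, Real.norm_eq_abs] at this
    exact mul_right_cancel₀ (norm_ne_zero_iff.2 hd) (by rw [this, one_mul])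
  rcases eq_or_eq_neg_of_abs_eq h2 with rfl | rfl
  · left; simpa using hk
  · right; simpa using hk

lemma map_eq_self_of_map_perp (f : Pt ≃ₗᵢ[ℝ] Pt) {d : Pt} (hd : d ≠ 0)
    (h : f (perp d) = perp d) (h' : f d = d) (v : Pt) : f v = v := by
  have hn : d 0 ^ 2 + d 1 ^ 2 ≠ 0 := by
    have := norm_ne_zero_iff.2 hd
    have h2 := EuclideanSpace.norm_sq_eq d
    rw [Fin.sum_univ_two, Real.norm_eq_abs, Real.norm_eq_abs, sq_abs, sq_abs] at h2
    rw [← h2]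
    positivity
  have hv : v = ((d 0 * v 0 + d 1 * v 1) / (d 0 ^ 2 + d 1 ^ 2)) • d +
      (det2 d v / (d 0 ^ 2 + d 1 ^ 2)) • perp d := by
    ext i
    fin_cases i
    · simp [perp, det2]
      field_simp
      ring
    · simp [perp, det2]
      field_simp
      ring
  rw [hv, map_add, map_smul, map_smul, h, h']

variable {Γ : Subgroup Iso2}

/-- The equivariant vector field supported on a free orbit with a prescribed value. -/
lemma exists_equivariantField_supported {x : Pt} (hx : ∀ g ∈ Γ, g x = x → g = 1) (v : Pt) :
    ∃ w ∈ equivariantFields Γ, (∀ g ∈ Γ, w (g x) = g.linearIsometryEquiv v) ∧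
      ∀ u, (∀ g ∈ Γ, g x ≠ u) → w u = 0 := by
  classical
  let w : Pt → Pt := fun u =>
    if h : ∃ g ∈ Γ, g x = u then (Classical.choose h).linearIsometryEquiv v else 0
  have hw1 : ∀ g ∈ Γ, w (g x) = g.linearIsometryEquiv v := by
    intro g hg
    have h : ∃ h ∈ Γ, h x = g x := ⟨g, hg, rfl⟩
    have hch := Classical.choose_spec h
    have heq : Classical.choose h = g := by
      have h1 : g⁻¹ * Classical.choose h = 1 := by
        refine hx _ (Γ.mul_mem (Γ.inv_mem hg) hch.1) ?_
        rw [AffineIsometryEquiv.coe_mul, Function.comp_apply, hch.2, AffineIsometryEquiv.coe_inv,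
          AffineIsometryEquiv.symm_apply_apply]
      rw [inv_mul_eq_one] at h1
      exact h1.symm
    simp only [w, dif_pos h]
    rw [heq]
  have hw2 : ∀ u, (∀ g ∈ Γ, g x ≠ u) → w u = 0 := by
    intro u hu
    have h : ¬ ∃ g ∈ Γ, g x = u := by
      rintro ⟨g, hg, hgu⟩
      exact hu g hg hgu
    simp only [w, dif_neg h]
  refine ⟨w, ?_, hw1, hw2⟩
  intro g hg u
  by_cases h : ∃ h ∈ Γ, h x = u
  · obtain ⟨h, hh, rfl⟩ := h
    have : g (h x) = (g * h) x := rfl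
    rw [this, hw1 _ (Γ.mul_mem hg hh), hw1 h hh]
    rfl
  · rw [hw2 u (fun h' hh' hu => h ⟨h', hh', hu⟩), map_zero]
    refine hw2 _ fun h' hh' hu => h ⟨g⁻¹ * h', Γ.mul_mem (Γ.inv_mem hg) hh', ?_⟩
    rw [AffineIsometryEquiv.coe_mul, Function.comp_apply, hu, AffineIsometryEquiv.coe_inv,
      AffineIsometryEquiv.symm_apply_apply]

/-- Three collinear points can be brought into convex position, to first order, by an
equivariant vector field. -/
lemma exists_bend_ne_zero {x y z : Pt} {k : ℝ} (hxy : x ≠ y) (hk : 0 < k)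
    (hz : z - x = k • (x - y)) (hx : ∀ g ∈ Γ, g x = x → g = 1)
    (htr : ∀ g ∈ Γ, g x = y → ¬ IsTranslation g)
    (hmid : ∀ g ∈ Γ, g (midpoint ℝ x y) = midpoint ℝ x y → g = 1) :
    ∃ w ∈ equivariantFields Γ, bend y x z w ≠ 0 := by
  set d := x - y with hd
  have hd0 : d ≠ 0 := sub_ne_zero.2 hxy
  obtain ⟨w, hw, hw1, hw2⟩ := exists_equivariantField_supported hx (perp d)
  have hnorm : ∀ u, ‖w u‖ ≤ ‖perp d‖ := by
    intro u
    by_cases h : ∃ h ∈ Γ, h x = u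
    · obtain ⟨h, hh, rfl⟩ := h
      rw [hw1 h hh, LinearIsometryEquiv.norm_map]
    · rw [hw2 u (fun h' hh' hu => h ⟨h', hh', hu⟩), norm_zero]
      exact norm_nonneg _
  have hwx : w x = perp d := hw1 1 Γ.one_mem
  refine ⟨w, hw, fun h0 => ?_⟩
  rw [bend_apply, hz, hwx, ← hd, det2_smul_right, ← det2_neg_swap] at h0
  have h1 := det2_perp_sub_nonneg (hnorm y)
  have h2 := det2_perp_sub_nonneg (hnorm z)
  have h3 : det2 d (perp d - w y) = 0 := by
    have h4 : det2 d (w z - perp d) = -det2 d (perp d - w z) := by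
      rw [det2_sub_right, det2_sub_right]; ring
    rw [h4] at h0
    nlinarith
  have hwy := eq_perp_of_det2_sub_eq_zero (hnorm y) h3
  have hp0 : perp d ≠ 0 := by
    intro h
    apply hd0
    have e0 := congrArg (fun v : Pt => v 0) h
    have e1 := congrArg (fun v : Pt => v 1) h
    simp [perp] at e0 e1
    ext i
    fin_cases i
    · simpa using e1
    · simpa using e0
  obtain ⟨g, hg, hgx⟩ : ∃ g ∈ Γ, g x = y := by
    by_contra h
    exact hp0 (hwy ▸ hw2 y (fun h' hh' hu => h ⟨h', hh', hu⟩))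
  have hgp : g.linearIsometryEquiv (perp d) = perp d := by
    rw [← hw1 g hg, hgx, hwy]
  rcases map_eq_or_eq_neg_of_map_perp _ hd0 hgp with h5 | h5
  · refine htr g hg hgx ⟨y - x, sub_ne_zero.2 hxy.symm, fun u => ?_⟩
    have h6 := map_eq_self_of_map_perp _ hd0 hgp h5 (u - x)
    rw [Iso2.linear_sub, hgx] at h6
    rw [sub_eq_iff_eq_add.1 h6]
    abel
  · have h6 : g (midpoint ℝ x y) = midpoint ℝ x y := by
      have h7 : midpoint ℝ x y = x + (-(1 / 2 : ℝ)) • d := by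
        rw [midpoint_eq_smul_add, hd, invOf_eq_inv]
        module
      rw [h7, Iso2.map_add, map_smul, h5, hgx, hd]
      module
    rw [hmid g hg h6] at hgx
    exact hxy hgx

end EquivariantFields

section Scalings

open Filter Topology

variable {Γ : Subgroup Iso2} {n : ℕ} {e : Fin n → Bool → Pt}

lemma IsFrame.notMem_openSeg (F : IsFrame Γ e) (i : Fin n) (b : Bool) : e i b ∉ openSeg e i := by
  rw [openSeg_eq e i b]
  intro h
  exact F.ne_not i b (left_mem_openSegment_iff.1 h)

lemma IsFrame.apply_notMem_image_openSeg (F : IsFrame Γ e) (i : Fin n) (b : Bool) (g : Iso2) :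
    g (e i b) ∉ g '' openSeg e i := by
  rintro ⟨y, hy, h⟩
  rw [g.injective h] at hy
  exact F.notMem_openSeg i b hy

lemma IsFrame.mem_openSeg_one (i : Fin n) {x : Pt} (h : x ∈ openSeg e i) :
    x ∈ (1 : Iso2) '' openSeg e i := ⟨x, h, rfl⟩

lemma IsFrame.eq_of_end_eq (F : IsFrame Γ e) {i : Fin n} {b c : Bool} (h : e i b = e i c) :
    b = c := by
  by_contra hbc
  have : c = !b := by cases b <;> cases c <;> simp_all
  rw [this] at h
  exact F.ne_not i b h

/-- There is an equivariant vector field that bends all collinear contacts of endpoints. -/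
lemma IsFrame.exists_field (F : IsFrame Γ e) :
    ∃ w ∈ equivariantFields Γ, ∀ i j b c, ∀ g ∈ Γ, g (e j c) = e i b → ¬ (i = j ∧ g = 1) →
      det2 (e i b - e i !b) (g (e j !c) - e i b) = 0 →
      bend (e i !b) (e i b) (g (e j !c)) w ≠ 0 := by
  let ι := {q : (Fin n × Fin n × Bool × Bool) × Iso2 // q.2 ∈ Γ ∧
    q.2 (e q.1.2.1 q.1.2.2.2) = e q.1.1 q.1.2.2.1 ∧ ¬ (q.1.1 = q.1.2.1 ∧ q.2 = 1) ∧
    det2 (e q.1.1 q.1.2.2.1 - e q.1.1 !q.1.2.2.1)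
      (q.2 (e q.1.2.1 !q.1.2.2.2) - e q.1.1 q.1.2.2.1) = 0}
  have : Finite ι := by
    refine Finite.of_injective (fun q : ι => q.1.1) ?_
    rintro ⟨⟨⟨i, j, b, c⟩, g⟩, hg, hgx, _⟩ ⟨⟨⟨i', j', b', c'⟩, g'⟩, hg', hgx', _⟩ hq
    simp only [Prod.mk.injEq] at hq
    obtain ⟨rfl, rfl, rfl, rfl⟩ := hq
    have := F.eq_of_apply_eq (mem_seg e j c) hg hg' (hgx.trans hgx'.symm)
    subst this
    rfl
  obtain ⟨w, hw, h⟩ := Module.Dual.exists_forall_mem_ne_zero_of_forall_exists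
    (equivariantFields Γ)
    (fun q : ι => bend (e q.1.1.1 !q.1.1.2.2.1) (e q.1.1.1 q.1.1.2.2.1)
      (q.1.2 (e q.1.1.2.1 !q.1.1.2.2.2))) (by
    rintro ⟨⟨⟨i, j, b, c⟩, g⟩, hg, hgx, hne, h0⟩
    dsimp only at hg hgx hne h0 ⊢
    have hxz : e i b ≠ g (e j !c) := by
      rw [← hgx]
      exact g.injective.ne (F.ne_not j c)
    obtain ⟨k, hk, hz⟩ := exists_pos_smul_of_det2_eq_zero (F.ne_not i b) hxz h0 (by
      intro u hu hu'
      rw [← openSeg_eq] at hu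
      rw [← hgx, ← Iso2.image_openSegment, ← openSeg_eq] at hu'
      obtain ⟨h1, h2⟩ := F.interior i j 1 Γ.one_mem g hg u (IsFrame.mem_openSeg_one i hu) hu'
      exact hne ⟨h1, h2.symm⟩)
    refine exists_bend_ne_zero (F.ne_not i b) hk hz (F.free i _ (mem_seg e i b)) ?_ ?_
    · intro h hh hhx
      refine F.transl i h hh ?_ ⟨e i !b, ⟨e i b, mem_seg e i b, hhx⟩, mem_seg e i _⟩
      rintro rfl
      exact F.ne_not i b hhx
    · refine F.free i _ ?_
      rw [seg_eq e i b]
      exact midpoint_mem_segment _ _)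
  exact ⟨w, hw, fun i j b c g hg h1 h2 h3 => h ⟨⟨⟨i, j, b, c⟩, g⟩, hg, h1, h2, h3⟩⟩

/-- The position at time `t` of an endpoint moving along a vector field. -/
def moved (e : Fin n → Bool → Pt) (w : Pt → Pt) (t : ℝ) (i : Fin n) (b : Bool) : Pt :=
  e i b + t • w (e i b)

lemma continuous_moved (w : Pt → Pt) (i : Fin n) (b : Bool) :
    Continuous fun t => moved e w t i b := by
  unfold moved
  fun_prop

lemma moved_zero (w : Pt → Pt) (i : Fin n) (b : Bool) : moved e w 0 i b = e i b := by
  simp [moved]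

lemma apply_moved {w : Pt → Pt} (hw : w ∈ equivariantFields Γ) {g : Iso2} (hg : g ∈ Γ) (t : ℝ)
    (i : Fin n) (b : Bool) : g (moved e w t i b) = g (e i b) + t • w (g (e i b)) := by
  unfold moved
  rw [Iso2.map_add, map_smul, hw g hg]

/-- Scaling factors that describe how far each moved segment has to be extended or truncated
at its ends. -/
structure IsScaling (Γ : Subgroup Iso2) (e : Fin n → Bool → Pt) (w : Pt → Pt)
    (lam : Fin n → Bool → ℝ → ℝ) : Prop where
  tendsto : ∀ i b, Tendsto (lam i b) (𝓝[>] 0) (𝓝 1)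
  interior : ∀ i b j, ∀ g ∈ Γ, e i b ∈ g '' openSeg e j → ∀ᶠ t in 𝓝[>] (0 : ℝ),
    det2 (moved e w t i (!b) + lam i b t • (moved e w t i b - moved e w t i !b) -
      g (moved e w t j false)) (g (moved e w t j true) - g (moved e w t j false)) = 0
  endpoint : ∀ i b j c, ∀ g ∈ Γ, g (e j c) = e i b → ¬ (i = j ∧ g = 1) →
    (∀ t, lam i b t = 1 ∧ lam j c t = 1 + t) ∨ ∀ t, lam j c t = 1 ∧ lam i b t = 1 + t

lemma IsFrame.det2_ne_zero (F : IsFrame Γ e) {i j : Fin n} {b : Bool} {g : Iso2} (hg : g ∈ Γ)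
    (h : e i b ∈ g '' openSeg e j) :
    det2 (e i b - e i !b) (g (e j true) - g (e j false)) ≠ 0 := by
  have h' := h
  unfold openSeg at h'
  rw [Iso2.image_openSegment] at h'
  refine det2_ne_zero_of_mem_openSegment (g.injective.ne (F.ne j)) h' fun u hu hu' => ?_
  rw [← openSeg_eq] at hu
  rw [← Iso2.image_openSegment] at hu'
  obtain ⟨rfl, rfl⟩ := F.interior i j 1 Γ.one_mem g hg u (IsFrame.mem_openSeg_one i hu) hu'
  exact F.apply_notMem_image_openSeg i b 1 h

/-- An end of a moved segment can be adjusted so that it lies on the line of the moved segment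
in whose interior it lies at time zero. -/
lemma IsFrame.exists_scaling_interior (F : IsFrame Γ e) (w : Pt → Pt) {i j : Fin n} {b : Bool}
    {g : Iso2} (hg : g ∈ Γ) (h : e i b ∈ g '' openSeg e j) :
    ∃ lam : ℝ → ℝ, Tendsto lam (𝓝[>] 0) (𝓝 1) ∧ ∀ᶠ t in 𝓝[>] (0 : ℝ),
      det2 (moved e w t i (!b) + lam t • (moved e w t i b - moved e w t i !b) -
        g (moved e w t j false)) (g (moved e w t j true) - g (moved e w t j false)) = 0 := by
  have h0 := F.det2_ne_zero hg h
  have hc1 := continuous_moved (e := e) w i b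
  have hc2 := continuous_moved (e := e) w i !b
  have hc3 := g.continuous.comp (continuous_moved (e := e) w j false)
  have hc4 := g.continuous.comp (continuous_moved (e := e) w j true)
  let A : ℝ → ℝ := fun t => det2 (g (moved e w t j false) - moved e w t i !b)
    (g (moved e w t j true) - g (moved e w t j false))
  let B : ℝ → ℝ := fun t => det2 (moved e w t i b - moved e w t i !b)
    (g (moved e w t j true) - g (moved e w t j false))
  have hA : Continuous A := continuous_det2.comp ((hc3.sub hc2).prodMk (hc4.sub hc3))
  have hB : Continuous B := continuous_det2.comp ((hc1.sub hc2).prodMk (hc4.sub hc3))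
  have hB0 : B 0 ≠ 0 := by
    simpa only [B, moved_zero] using h0
  have hAB : A 0 = B 0 := by
    unfold openSeg at h
    rw [Iso2.image_openSegment] at h
    obtain ⟨s, -, -, hs⟩ := mem_openSegment_iff_exists.1 h
    simp only [A, B, moved_zero]
    rw [hs]
    simp only [det2_sub_left, det2_add_left, det2_smul_left, det2_sub_right]
    simp only [det2]
    ring
  refine ⟨fun t => A t / B t, ?_, ?_⟩
  · have : ContinuousAt (fun t => A t / B t) 0 := hA.continuousAt.div hB.continuousAt hB0
    have h1 := this.tendsto
    rw [hAB, div_self hB0] at h1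
    exact h1.mono_left nhdsWithin_le_nhds
  · have : ∀ᶠ t in 𝓝[>] (0 : ℝ), B t ≠ 0 :=
      nhdsWithin_le_nhds (hB.continuousAt.eventually_ne hB0)
    filter_upwards [this] with t ht
    have h1 : A t / B t * B t = A t := div_mul_cancel₀ _ ht
    rw [add_sub_right_comm, det2_add_left, det2_smul_left]
    change _ + A t / B t * B t = 0
    rw [h1]
    simp only [A, det2_sub_left]
    ring

lemma IsFrame.exists_isScaling (F : IsFrame Γ e) (w : Pt → Pt) :
    ∃ lam, IsScaling Γ e w lam := by
  let rank : Fin n → Bool → ℕ := fun i b => Encodable.encode (i, b)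
  have hrank : ∀ i b j c, rank i b = rank j c → i = j ∧ b = c := by
    intro i b j c h
    simpa using Encodable.encode_injective h
  let Interior : Fin n → Bool → Prop := fun i b => ∃ j, ∃ g ∈ Γ, e i b ∈ g '' openSeg e j
  let Below : Fin n → Bool → Prop := fun i b =>
    ∃ j c, ∃ g ∈ Γ, g (e j c) = e i b ∧ rank i b < rank j c
  have hlam : ∀ i b, ∃ lam : ℝ → ℝ, Tendsto lam (𝓝[>] 0) (𝓝 1) ∧
      (∀ j, ∀ g ∈ Γ, e i b ∈ g '' openSeg e j → ∀ᶠ t in 𝓝[>] (0 : ℝ),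
        det2 (moved e w t i (!b) + lam t • (moved e w t i b - moved e w t i !b) -
        g (moved e w t j false)) (g (moved e w t j true) - g (moved e w t j false)) = 0) ∧
      (¬ Interior i b → Below i b → ∀ t, lam t = 1) ∧
      (¬ Interior i b → ¬ Below i b → ∀ t, lam t = 1 + t) := by
    intro i b
    by_cases hI : Interior i b
    · obtain ⟨j, g, hg, h⟩ := id hI
      obtain ⟨lam, h1, h2⟩ := F.exists_scaling_interior w hg h
      refine ⟨lam, h1, ?_, fun h' => absurd hI h', fun h' => absurd hI h'⟩
      intro j' g' hg' h'
      obtain ⟨rfl, rfl⟩ := F.interior j j' g hg g' hg' _ h h'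
      exact h2
    · have hI' : ∀ j, ∀ g ∈ Γ, e i b ∉ g '' openSeg e j :=
        fun j g hg h => hI ⟨j, g, hg, h⟩
      by_cases hB : Below i b
      · exact ⟨fun _ => 1, tendsto_const_nhds, fun j g hg h => absurd h (hI' j g hg),
          fun _ _ _ => rfl, fun _ h' => absurd hB h'⟩
      · refine ⟨fun t => 1 + t, ?_, fun j g hg h => absurd h (hI' j g hg),
          fun _ h' => absurd h' hB, fun _ _ _ => rfl⟩
        have : Tendsto (fun t : ℝ => 1 + t) (𝓝 0) (𝓝 (1 + 0)) :=
          (continuous_const.add continuous_id).tendsto 0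
        rw [add_zero] at this
        exact this.mono_left nhdsWithin_le_nhds
  choose lam h1 h2 h3 h4 using hlam
  have hmem : ∀ {i b j c g}, g (e j c) = e i b → e i b ∈ g '' seg e j := by
    intro i b j c g h
    exact ⟨_, mem_seg e j c, h⟩
  have hmem1 : ∀ i b, e i b ∈ (1 : Iso2) '' seg e i := fun i b => ⟨_, mem_seg e i b, rfl⟩
  have hInt : ∀ i b j c, ∀ g ∈ Γ, g (e j c) = e i b → ¬ (i = j ∧ g = 1) → ¬ Interior i b := by
    rintro i b j c g hg hgx hne ⟨k, h, hh, hx⟩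
    rcases F.two i j k 1 Γ.one_mem g hg h hh _ (hmem1 i b) (hmem hgx)
      (Set.image_mono (openSeg_subset_seg e k) hx) with H | H | H
    · exact hne ⟨H.1, H.2.symm⟩
    · obtain ⟨rfl, rfl⟩ := H
      exact F.apply_notMem_image_openSeg i b 1 hx
    · obtain ⟨rfl, rfl⟩ := H
      rw [← hgx] at hx
      exact F.apply_notMem_image_openSeg j c g hx
  have hswap : ∀ {i b j c} {g : Iso2}, g (e j c) = e i b → g⁻¹ (e i b) = e j c := by
    intro i b j c g h
    rw [← h, AffineIsometryEquiv.coe_inv, AffineIsometryEquiv.symm_apply_apply]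
  have hne' : ∀ {i j} {g : Iso2}, ¬ (i = j ∧ g = 1) → ¬ ((j : Fin n) = i ∧ g⁻¹ = 1) := by
    rintro i j g hne ⟨rfl, h⟩
    exact hne ⟨rfl, inv_eq_one.1 h⟩
  have key : ∀ i b j c, ∀ g ∈ Γ, g (e j c) = e i b → ¬ (i = j ∧ g = 1) → rank i b < rank j c →
      ∀ t, lam i b t = 1 ∧ lam j c t = 1 + t := by
    intro i b j c g hg hgx hne hlt t
    refine ⟨h3 i b (hInt i b j c g hg hgx hne) ⟨j, c, g, hg, hgx, hlt⟩ t, h4 j c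
      (hInt j c i b g⁻¹ (Γ.inv_mem hg) (hswap hgx) (hne' hne)) ?_ t⟩
    rintro ⟨k, d, h, hh, hhx, hlt'⟩
    have hghx : (g * h) (e k d) = e i b := by
      rw [AffineIsometryEquiv.coe_mul, Function.comp_apply, hhx, hgx]
    rcases F.two i j k 1 Γ.one_mem g hg (g * h) (Γ.mul_mem hg hh) _ (hmem1 i b) (hmem hgx)
      (hmem hghx) with H | H | H
    · exact hne ⟨H.1, H.2.symm⟩
    · obtain ⟨rfl, H⟩ := H
      rw [← H] at hghx
      have := F.eq_of_end_eq (b := d) (c := b) hghx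
      subst this
      exact absurd (hlt.trans hlt') (lt_irrefl _)
    · obtain ⟨rfl, H⟩ := H
      have hh1 : h = 1 := by simpa using H
      rw [hh1] at hhx
      have := F.eq_of_end_eq (b := d) (c := c) hhx
      subst this
      exact absurd hlt' (lt_irrefl _)
  refine ⟨lam, h1, h2, ?_⟩
  intro i b j c g hg hgx hne
  rcases lt_trichotomy (rank i b) (rank j c) with H | H | H
  · exact Or.inl (key i b j c g hg hgx hne H)
  · obtain ⟨rfl, rfl⟩ := hrank _ _ _ _ H
    exact absurd ⟨rfl, F.free i _ (mem_seg e i b) g hg hgx⟩ hne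
  · exact Or.inr (key j c i b g⁻¹ (Γ.inv_mem hg) (hswap hgx) (hne' hne) H)

end Scalings

section Contacts

open Filter Topology

/-- Two segments that meet and are in generic position. -/
def GenericContact (S T : Set Pt) : Prop := (S ∩ T).Nonempty ∧ GenericPair S T

lemma GenericContact.symm {S T : Set Pt} (h : GenericContact S T) : GenericContact T S :=
  ⟨by rw [Set.inter_comm]; exact h.1, h.2.symm⟩

lemma GenericContact.image {S T : Set Pt} (g : Iso2) (h : GenericContact S T) :
    GenericContact (g '' S) (g '' T) := by
  refine ⟨?_, h.2.image g⟩
  obtain ⟨x, h1, h2⟩ := h.1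
  exact ⟨g x, ⟨x, h1, rfl⟩, ⟨x, h2, rfl⟩⟩

lemma genericContact_of_mem_openSegment {a b c d : Pt} (ha : a ∈ openSegment ℝ c d)
    (hc : det2 (b - a) (d - c) ≠ 0) : GenericContact (segment ℝ a b) (segment ℝ c d) :=
  ⟨⟨a, left_mem_segment ℝ a b, openSegment_subset_segment ℝ c d ha⟩,
    genericPair_of_mem_openSegment ha hc⟩

/-- Lying in an open segment is an open condition along curves of points on moving lines. -/
lemma eventually_mem_openSegment {α : Type*} {l : Filter α} {a c d : α → Pt} {a₀ c₀ d₀ : Pt}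
    (ha : Tendsto a l (𝓝 a₀)) (hc : Tendsto c l (𝓝 c₀)) (hd : Tendsto d l (𝓝 d₀))
    (hcd : c₀ ≠ d₀) (h : a₀ ∈ openSegment ℝ c₀ d₀)
    (hdet : ∀ᶠ t in l, det2 (a t - c t) (d t - c t) = 0) :
    ∀ᶠ t in l, a t ∈ openSegment ℝ (c t) (d t) := by
  obtain ⟨s, hs0, hs1, hs⟩ := mem_openSegment_iff_exists.1 h
  have hdc : d₀ - c₀ ≠ 0 := sub_ne_zero.2 hcd.symm
  have hin : inner ℝ (d₀ - c₀) (d₀ - c₀) ≠ 0 := inner_self_ne_zero.2 hdc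
  have hlim : Tendsto (fun t => inner ℝ (a t - c t) (d t - c t) /
      inner ℝ (d t - c t) (d t - c t)) l (𝓝 s) := by
    have h1 := (((ha.sub hc).inner (hd.sub hc)).div ((hd.sub hc).inner (hd.sub hc)) hin :
      Tendsto _ l (𝓝 (inner ℝ (a₀ - c₀) (d₀ - c₀) / inner ℝ (d₀ - c₀) (d₀ - c₀))))
    have h2 : inner ℝ (a₀ - c₀) (d₀ - c₀) / inner ℝ (d₀ - c₀) (d₀ - c₀) = s := by
      have h3 : a₀ - c₀ = s • (d₀ - c₀) := by rw [hs]; abel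
      rw [h3, real_inner_smul_left]
      exact mul_div_cancel_right₀ s hin
    rw [h2] at h1
    exact h1
  filter_upwards [hdet, hlim.eventually (lt_mem_nhds hs0), hlim.eventually (gt_mem_nhds hs1),
    (hd.sub hc).eventually_ne hdc] with t h1 h2 h3 h4
  rw [← det2_neg_swap, neg_eq_zero] at h1
  obtain ⟨k, hk⟩ := exists_eq_smul_of_det2_eq_zero h4 h1
  rw [hk, real_inner_smul_left, mul_div_cancel_right₀ k (inner_self_ne_zero.2 h4)] at h2 h3
  refine mem_openSegment_iff_exists.2 ⟨k, h2, h3, ?_⟩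
  rw [← hk]
  abel

variable {Γ : Subgroup Iso2} {n : ℕ} {e : Fin n → Bool → Pt}

/-- The endpoints of the perturbed segments. -/
def perturbed (e : Fin n → Bool → Pt) (w : Pt → Pt) (lam : Fin n → Bool → ℝ → ℝ) (t : ℝ)
    (i : Fin n) (b : Bool) : Pt :=
  moved e w t i (!b) + lam i b t • (moved e w t i b - moved e w t i !b)

variable {w : Pt → Pt} {lam : Fin n → Bool → ℝ → ℝ}

lemma IsScaling.tendsto_perturbed (S : IsScaling Γ e w lam) (i : Fin n) (b : Bool) :
    Tendsto (fun t => perturbed e w lam t i b) (𝓝[>] 0) (𝓝 (e i b)) := by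
  have hm : ∀ c, Tendsto (fun t => moved e w t i c) (𝓝[>] 0) (𝓝 (e i c)) := by
    intro c
    have := (continuous_moved (e := e) w i c).tendsto 0
    rw [moved_zero] at this
    exact this.mono_left nhdsWithin_le_nhds
  have := (hm !b).add ((S.tendsto i b).smul ((hm b).sub (hm !b)))
  rw [one_smul, add_sub_cancel] at this
  exact this

lemma perturbed_sub (t : ℝ) (i : Fin n) (b : Bool) :
    perturbed e w lam t i (!b) - perturbed e w lam t i b =
      (1 - lam i b t - lam i (!b) t) • (moved e w t i b - moved e w t i !b) := by
  unfold perturbed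
  rw [Bool.not_not]
  module

lemma IsScaling.eventually_ne_zero (S : IsScaling Γ e w lam) (i : Fin n) (b : Bool) :
    ∀ᶠ t in 𝓝[>] (0 : ℝ), 1 - lam i b t - lam i (!b) t ≠ 0 := by
  have := (tendsto_const_nhds (x := (1 : ℝ))).sub (S.tendsto i b) |>.sub (S.tendsto i !b)
  refine this.eventually_ne ?_
  norm_num

lemma IsScaling.eventually_genericContact_of_mem_openSeg (F : IsFrame Γ e)
    (S : IsScaling Γ e w lam) {i j : Fin n} {b : Bool} {g : Iso2} (hg : g ∈ Γ)
    (h : e i b ∈ g '' openSeg e j) :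
    ∀ᶠ t in 𝓝[>] (0 : ℝ), GenericContact (seg (perturbed e w lam t) i)
      (g '' seg (perturbed e w lam t) j) := by
  have h0 := F.det2_ne_zero hg h
  have hgsub : ∀ t, g (perturbed e w lam t j true) - g (perturbed e w lam t j false) =
      (1 - lam j false t - lam j true t) •
        (g (moved e w t j false) - g (moved e w t j true)) := by
    intro t
    rw [← Iso2.linear_sub, ← Iso2.linear_sub, ← map_smul]
    exact congrArg _ (perturbed_sub t j false)
  have hgfalse : ∀ t, g (perturbed e w lam t j false) = g (moved e w t j true) +
      lam j false t • (g (moved e w t j false) - g (moved e w t j true)) := by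
    intro t
    unfold perturbed
    rw [Iso2.map_add, map_smul, Iso2.linear_sub]
    rfl
  have hdet : ∀ᶠ t in 𝓝[>] (0 : ℝ), det2 (moved e w t i b - moved e w t i !b)
      (g (moved e w t j true) - g (moved e w t j false)) ≠ 0 := by
    have hc : Continuous fun t => det2 (moved e w t i b - moved e w t i !b)
        (g (moved e w t j true) - g (moved e w t j false)) :=
      continuous_det2.comp (((continuous_moved w i b).sub (continuous_moved w i !b)).prodMk
        ((g.continuous.comp (continuous_moved w j true)).sub
          (g.continuous.comp (continuous_moved w j false))))
    refine nhdsWithin_le_nhds (hc.continuousAt.eventually_ne ?_)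
    simpa only [moved_zero] using h0
  have hmem : ∀ᶠ t in 𝓝[>] (0 : ℝ), perturbed e w lam t i b ∈
      openSegment ℝ (g (perturbed e w lam t j false)) (g (perturbed e w lam t j true)) := by
    refine eventually_mem_openSegment (S.tendsto_perturbed i b)
      ((g.continuous.tendsto _).comp (S.tendsto_perturbed j false))
      ((g.continuous.tendsto _).comp (S.tendsto_perturbed j true))
      (g.injective.ne (F.ne j)) (by rwa [← Iso2.image_openSegment]) ?_
    filter_upwards [S.interior i b j g hg h] with t ht
    have hsplit : perturbed e w lam t i b - g (perturbed e w lam t j false) =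
        (perturbed e w lam t i b - g (moved e w t j false)) -
        (1 - lam j false t) • (g (moved e w t j true) - g (moved e w t j false)) := by
      rw [hgfalse]
      module
    have ht' : det2 (perturbed e w lam t i b - g (moved e w t j false))
      (g (moved e w t j true) - g (moved e w t j false)) = 0 := ht
    change det2 (perturbed e w lam t i b - g (perturbed e w lam t j false))
      (g (perturbed e w lam t j true) - g (perturbed e w lam t j false)) = 0
    rw [hgsub, det2_smul_right, ← neg_sub (g (moved e w t j true)), ← neg_one_smul ℝ,
      det2_smul_right, hsplit, det2_sub_left, ht', det2_smul_left, det2_self]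
    ring
  filter_upwards [hdet, hmem, S.eventually_ne_zero i b, S.eventually_ne_zero j false]
    with t h1 h2 h3 h4
  rw [seg_eq _ i b]
  unfold seg
  rw [Iso2.image_segment]
  refine genericContact_of_mem_openSegment h2 ?_
  rw [perturbed_sub, hgsub, det2_smul_left, det2_smul_right,
    ← neg_sub (g (moved e w t j true)), ← neg_one_smul ℝ, det2_smul_right]
  exact mul_ne_zero h3 (mul_ne_zero h4 (mul_ne_zero (by norm_num) h1))

/-- A bent contact of endpoints is not collinear for small positive times. -/
lemma eventually_det2_ne_zero {x y z : Pt}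
    (h : det2 (x - y) (z - x) = 0 → bend y x z w ≠ 0) : ∀ᶠ t in 𝓝[>] (0 : ℝ),
      det2 ((x + t • w x) - (y + t • w y)) ((z + t • w z) - (x + t • w x)) ≠ 0 := by
  have hexp : ∀ t : ℝ, det2 ((x + t • w x) - (y + t • w y)) ((z + t • w z) - (x + t • w x)) =
      det2 (x - y) (z - x) + t * (bend y x z w + t * det2 (w x - w y) (w z - w x)) := by
    intro t
    simp only [bend_apply, det2, PiLp.add_apply, PiLp.sub_apply, PiLp.smul_apply, smul_eq_mul]
    ring
  simp only [hexp]
  by_cases h0 : det2 (x - y) (z - x) = 0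
  · have hc : Continuous fun t : ℝ => bend y x z w + t * det2 (w x - w y) (w z - w x) := by
      fun_prop
    have h1 : ∀ᶠ t in 𝓝[>] (0 : ℝ), bend y x z w + t * det2 (w x - w y) (w z - w x) ≠ 0 := by
      refine nhdsWithin_le_nhds (hc.continuousAt.eventually_ne ?_)
      simpa using h h0
    filter_upwards [h1, self_mem_nhdsWithin] with t ht ht0
    rw [h0, zero_add]
    exact mul_ne_zero (ne_of_gt ht0) ht
  · have hc : Continuous fun t : ℝ => det2 (x - y) (z - x) +
        t * (bend y x z w + t * det2 (w x - w y) (w z - w x)) := by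
      fun_prop
    refine nhdsWithin_le_nhds (hc.continuousAt.eventually_ne ?_)
    simpa using h0

/-- A vector field that bends every collinear contact of endpoints. -/
def IsBending (e : Fin n → Bool → Pt) (Γ : Subgroup Iso2) (w : Pt → Pt) : Prop :=
  ∀ i j b c, ∀ g ∈ Γ, g (e j c) = e i b → ¬ (i = j ∧ g = 1) →
    det2 (e i b - e i !b) (g (e j !c) - e i b) = 0 →
    bend (e i !b) (e i b) (g (e j !c)) w ≠ 0

lemma IsScaling.eventually_genericContact_of_scaling
    (S : IsScaling Γ e w lam) (hw : w ∈ equivariantFields Γ) (hb : IsBending e Γ w)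
    {i j : Fin n} {b c : Bool} {g : Iso2} (hg : g ∈ Γ) (h : g (e j c) = e i b)
    (hne : ¬ (i = j ∧ g = 1)) (hlam : ∀ t, lam i b t = 1 ∧ lam j c t = 1 + t) :
    ∀ᶠ t in 𝓝[>] (0 : ℝ), GenericContact (seg (perturbed e w lam t) i)
      (g '' seg (perturbed e w lam t) j) := by
  filter_upwards [eventually_det2_ne_zero (hb i j b c g hg h hne), self_mem_nhdsWithin,
    (S.tendsto j !c).eventually (lt_mem_nhds one_pos), S.eventually_ne_zero i b] with t h1 h2 h3 h4
  have ht : 0 < t := h2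
  obtain ⟨l1, l2⟩ := hlam t
  have hx : g (moved e w t j c) = moved e w t i b := by
    rw [apply_moved hw hg, h]
    rfl
  have hp1 : perturbed e w lam t i b = moved e w t i b := by
    unfold perturbed
    rw [l1]
    module
  have hp2 : g (perturbed e w lam t j c) =
      moved e w t i b - t • (g (moved e w t j !c) - moved e w t i b) := by
    unfold perturbed
    rw [Iso2.map_add, map_smul, Iso2.linear_sub, hx, l2]
    module
  have hp3 : g (perturbed e w lam t j !c) =
      moved e w t i b + lam j (!c) t • (g (moved e w t j !c) - moved e w t i b) := by
    unfold perturbed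
    rw [Iso2.map_add, map_smul, Iso2.linear_sub, Bool.not_not, hx]
  have hz : g (moved e w t j !c) = g (e j !c) + t • w (g (e j !c)) := apply_moved hw hg t j !c
  rw [← hz] at h1
  rw [seg_eq _ i b, seg_eq _ j c, Iso2.image_segment]
  have hpos : 0 < t + lam j (!c) t := by linarith
  refine genericContact_of_mem_openSegment (mem_openSegment_iff_exists.2
    ⟨t / (t + lam j (!c) t), by positivity, by rw [div_lt_one hpos]; linarith, ?_⟩) ?_
  · have hsub : g (perturbed e w lam t j !c) - g (perturbed e w lam t j c) =
        (t + lam j (!c) t) • (g (moved e w t j !c) - moved e w t i b) := by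
      rw [hp2, hp3]
      module
    rw [hsub, smul_smul, div_mul_cancel₀ _ hpos.ne', hp1, hp2]
    abel
  · have hsub : g (perturbed e w lam t j !c) - g (perturbed e w lam t j c) =
        (t + lam j (!c) t) • (g (moved e w t j !c) - moved e w t i b) := by
      rw [hp2, hp3]
      module
    rw [hsub, perturbed_sub, det2_smul_left, det2_smul_right]
    exact mul_ne_zero h4 (mul_ne_zero hpos.ne' h1)

lemma eventually_genericContact_swap {i j : Fin n} {g : Iso2}
    (h : ∀ᶠ t in 𝓝[>] (0 : ℝ), GenericContact (seg (perturbed e w lam t) j)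
      ((g⁻¹ : Iso2) '' seg (perturbed e w lam t) i)) :
    ∀ᶠ t in 𝓝[>] (0 : ℝ), GenericContact (seg (perturbed e w lam t) i)
      (g '' seg (perturbed e w lam t) j) := by
  filter_upwards [h] with t ht
  have := (ht.image g).symm
  rwa [← Iso2.image_mul, mul_inv_cancel, AffineIsometryEquiv.coe_one, Set.image_id] at this

lemma mem_openSeg_or_exists_eq {i : Fin n} {x : Pt} (hx : x ∈ seg e i) :
    x ∈ openSeg e i ∨ ∃ b, x = e i b := by
  unfold seg at hx
  rw [← insert_endpoints_openSegment] at hx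
  rcases hx with hx | hx | hx
  exacts [Or.inr ⟨false, hx⟩, Or.inr ⟨true, hx⟩, Or.inl hx]

/-- Segments that meet are perturbed to segments in generic contact. -/
lemma IsScaling.eventually_genericContact (F : IsFrame Γ e)
    (S : IsScaling Γ e w lam) (hw : w ∈ equivariantFields Γ) (hb : IsBending e Γ w)
    {i j : Fin n} {g : Iso2} (hg : g ∈ Γ) (hne : ¬ (i = j ∧ g = 1))
    (hmeet : (seg e i ∩ g '' seg e j).Nonempty) :
    ∀ᶠ t in 𝓝[>] (0 : ℝ), GenericContact (seg (perturbed e w lam t) i)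
      (g '' seg (perturbed e w lam t) j) := by
  obtain ⟨x, hx, y, hy, hyx⟩ := hmeet
  have hinv : ∀ {u v}, g u = v → g⁻¹ v = u := by
    rintro u v rfl
    rw [AffineIsometryEquiv.coe_inv, AffineIsometryEquiv.symm_apply_apply]
  rcases mem_openSeg_or_exists_eq hx with hx | ⟨b, rfl⟩
  · rcases mem_openSeg_or_exists_eq hy with hy | ⟨c, rfl⟩
    · obtain ⟨h1, h2⟩ := F.interior i j 1 Γ.one_mem g hg x (IsFrame.mem_openSeg_one i hx)
        ⟨y, hy, hyx⟩
      exact absurd ⟨h1, h2.symm⟩ hne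
    · exact eventually_genericContact_swap (S.eventually_genericContact_of_mem_openSeg F
        (b := c) (Γ.inv_mem hg) ⟨x, hx, hinv hyx⟩)
  · rcases mem_openSeg_or_exists_eq hy with hy | ⟨c, rfl⟩
    · exact S.eventually_genericContact_of_mem_openSeg F hg ⟨y, hy, hyx⟩
    · rcases S.endpoint i b j c g hg hyx hne with H | H
      · exact S.eventually_genericContact_of_scaling hw hb hg hyx hne H
      · refine eventually_genericContact_swap (S.eventually_genericContact_of_scaling hw hb
          (Γ.inv_mem hg) (hinv hyx) ?_ H)
        rintro ⟨rfl, h⟩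
        exact hne ⟨rfl, inv_eq_one.1 h⟩

end Contacts

section Perturbation

open Filter Topology

lemma IsIntPt.mem {x : Pt} {S : Set Pt} (h : IsIntPt x S) : x ∈ S := by
  obtain ⟨p, q, -, rfl, hx⟩ := h
  exact openSegment_subset_segment ℝ p q hx

lemma IsEndpt.mem {x : Pt} {S : Set Pt} (h : IsEndpt x S) : x ∈ S := by
  obtain ⟨p, q, -, rfl, rfl | rfl⟩ := h
  exacts [left_mem_segment ℝ _ _, right_mem_segment ℝ _ _]

lemma genericPair_of_not_nonempty_inter {S T : Set Pt} (h : ¬ (S ∩ T).Nonempty) :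
    GenericPair S T :=
  ⟨fun x h1 h2 => h ⟨x, h1.mem, h2.mem⟩, fun x h1 h2 => h ⟨x, h1.mem, h2.mem⟩⟩

lemma not_genericPair_of_eq {S T : Set Pt} (hST : S = T) (hS : IsSeg S) :
    ¬ GenericPair S T := by
  subst hST
  obtain ⟨p, q, hpq, rfl⟩ := hS
  intro h
  have hp : IsEndpt p (segment ℝ p q) := ⟨p, q, hpq, rfl, Or.inl rfl⟩
  exact h.2 p hp hp

variable {Γ : Subgroup Iso2} {n : ℕ} {e f : Fin n → Bool → Pt}

lemma image_seg (g : Iso2) (i : Fin n) :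
    g '' seg e i = segment ℝ (g (e i false)) (g (e i true)) :=
  Iso2.image_segment g _ _

lemma exists_mem_image_seg_dist_lt {r : ℝ} {i : Fin n} (hr : ∀ b, dist (e i b) (f i b) < r)
    (g : Iso2) {x : Pt} (hx : x ∈ g '' seg e i) : ∃ y ∈ g '' seg f i, dist x y < r := by
  rw [image_seg] at hx ⊢
  refine exists_mem_segment_dist_lt ?_ ?_ hx <;>
  · rw [g.dist_map]
    exact hr _

/-- The families `e` and `f` have the same intersection pattern of translates under `Γ`, and
distinct translates of the segments of `f` are in generic position. -/
structure IsGenericCopy (Γ : Subgroup Iso2) {n : ℕ} (e f : Fin n → Bool → Pt) : Prop where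
  ne : ∀ i, f i false ≠ f i true
  inter : ∀ i j, ∀ g ∈ Γ, ¬ (i = j ∧ g = 1) →
    ((seg e i ∩ g '' seg e j).Nonempty ↔ (seg f i ∩ g '' seg f j).Nonempty)
  generic : ∀ i j, ∀ g ∈ Γ, ¬ (i = j ∧ g = 1) → GenericPair (seg f i) (g '' seg f j)

variable {w : Pt → Pt} {lam : Fin n → Bool → ℝ → ℝ}

lemma IsScaling.eventually_dist_lt (S : IsScaling Γ e w lam) {r : ℝ} (hr : 0 < r) :
    ∀ᶠ t in 𝓝[>] (0 : ℝ), ∀ i b, dist (e i b) (perturbed e w lam t i b) < r := by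
  refine eventually_all.2 fun i => eventually_all.2 fun b => ?_
  filter_upwards [(S.tendsto_perturbed i b).eventually (Metric.ball_mem_nhds _ hr)] with t ht
  rw [dist_comm]
  exact ht

lemma IsScaling.eventually_not_nonempty_inter (S : IsScaling Γ e w lam) {i j : Fin n} {g : Iso2}
    (h : ¬ (seg e i ∩ g '' seg e j).Nonempty) :
    ∀ᶠ t in 𝓝[>] (0 : ℝ), ¬ (seg (perturbed e w lam t) i ∩
      g '' seg (perturbed e w lam t) j).Nonempty := by
  have hc : ∀ a b : Pt, IsCompact (segment ℝ a b) := fun a b => by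
    rw [segment_eq_image']
    exact isCompact_Icc.image (by fun_prop)
  have hd : Disjoint (seg e i) (g '' seg e j) :=
    Set.disjoint_iff_inter_eq_empty.2 (Set.not_nonempty_iff_eq_empty.1 h)
  have hcl : IsClosed (g '' seg e j) := by
    rw [image_seg]
    exact (hc _ _).isClosed
  obtain ⟨δ, hδ, hdis⟩ := hd.exists_thickenings (hc _ _) hcl
  filter_upwards [S.eventually_dist_lt hδ] with t ht
  rintro ⟨x, hx, hx'⟩
  have hr : ∀ k b, dist (perturbed e w lam t k b) (e k b) < δ := fun k b => by
    rw [dist_comm]; exact ht k b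
  obtain ⟨y, hy, hxy⟩ := exists_mem_segment_dist_lt (hr i false) (hr i true) hx
  obtain ⟨z, hz, hxz⟩ := exists_mem_image_seg_dist_lt (hr j) g hx'
  exact Set.disjoint_left.1 hdis (Metric.mem_thickening_iff.2 ⟨y, hy, hxy⟩)
    (Metric.mem_thickening_iff.2 ⟨z, hz, hxz⟩)

/-- A frame can be perturbed by an arbitrarily small amount to a family in generic position with
the same intersection pattern. -/
lemma IsFrame.exists_isGenericCopy (F : IsFrame Γ e) {r : ℝ} (hr : 0 < r) :
    ∃ f, IsGenericCopy Γ e f ∧ ∀ i b, dist (e i b) (f i b) < r := by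
  obtain ⟨w, hw, hb⟩ := F.exists_field
  obtain ⟨lam, S⟩ := F.exists_isScaling w
  have hne : ∀ᶠ t in 𝓝[>] (0 : ℝ), ∀ i,
      perturbed e w lam t i false ≠ perturbed e w lam t i true :=
    eventually_all.2 fun i =>
      ((S.tendsto_perturbed i false).sub (S.tendsto_perturbed i true)).eventually_ne
        (sub_ne_zero.2 (F.ne i)) |>.mono fun _ h => sub_ne_zero.1 h
  have hnear : ∀ᶠ t in 𝓝[>] (0 : ℝ), ∀ i j,
      ∀ g ∈ {g : Iso2 | g ∈ Γ ∧ ∃ x ∈ seg e i, ∃ y ∈ g '' seg e j, dist x y ≤ 1},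
      ¬ (i = j ∧ g = 1) →
      ((seg e i ∩ g '' seg e j).Nonempty → GenericContact (seg (perturbed e w lam t) i)
        (g '' seg (perturbed e w lam t) j)) ∧
      (¬ (seg e i ∩ g '' seg e j).Nonempty → ¬ (seg (perturbed e w lam t) i ∩
        g '' seg (perturbed e w lam t) j).Nonempty) := by
    refine eventually_all.2 fun i => eventually_all.2 fun j => ?_
    rw [Filter.eventually_all_finite (F.finite_near i j)]
    rintro g ⟨hg, -⟩
    by_cases hij : i = j ∧ g = 1
    · exact Eventually.of_forall fun t h => absurd hij h
    by_cases hm : (seg e i ∩ g '' seg e j).Nonempty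
    · filter_upwards [S.eventually_genericContact F hw hb hg hij hm] with t ht
      exact fun _ => ⟨fun _ => ht, fun h => absurd hm h⟩
    · filter_upwards [S.eventually_not_nonempty_inter hm] with t ht
      exact fun _ => ⟨fun h => absurd h hm, fun _ => ht⟩
  obtain ⟨t, h1, h2, h3, h4⟩ := (hne.and (hnear.and ((S.eventually_dist_lt hr).and
    (S.eventually_dist_lt (r := 1 / 2) one_half_pos)))).exists
  have key : ∀ i j, ∀ g ∈ Γ, ¬ (i = j ∧ g = 1) →
      ((seg e i ∩ g '' seg e j).Nonempty → GenericContact (seg (perturbed e w lam t) i)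
        (g '' seg (perturbed e w lam t) j)) ∧
      (¬ (seg e i ∩ g '' seg e j).Nonempty → ¬ (seg (perturbed e w lam t) i ∩
        g '' seg (perturbed e w lam t) j).Nonempty) := by
    intro i j g hg hij
    by_cases hn : ∃ x ∈ seg e i, ∃ y ∈ g '' seg e j, dist x y ≤ 1
    · exact h2 i j g ⟨hg, hn⟩ hij
    · refine ⟨fun ⟨x, hx, hx'⟩ => absurd ⟨x, hx, x, hx', by simp⟩ hn, ?_⟩
      rintro - ⟨x, hx, hx'⟩
      have hr : ∀ k b, dist (perturbed e w lam t k b) (e k b) < 1 / 2 := fun k b => by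
        rw [dist_comm]; exact h4 k b
      obtain ⟨y, hy, hxy⟩ := exists_mem_segment_dist_lt (hr i false) (hr i true) hx
      obtain ⟨z, hz, hxz⟩ := exists_mem_image_seg_dist_lt (hr j) g hx'
      exact hn ⟨y, hy, z, hz, by linarith [dist_triangle_left y z x]⟩
  refine ⟨_, ⟨h1, fun i j g hg hij => ?_, fun i j g hg hij => ?_⟩, h3⟩
  · exact ⟨fun h => ((key i j g hg hij).1 h).1,
      fun h => by_contra fun h' => (key i j g hg hij).2 h' h⟩
  · by_cases hm : (seg e i ∩ g '' seg e j).Nonempty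
    · exact ((key i j g hg hij).1 hm).2
    · exact genericPair_of_not_nonempty_inter ((key i j g hg hij).2 hm)

lemma IsGenericCopy.genericPair_image (G : IsGenericCopy Γ e f) {i j : Fin n} {g h : Iso2}
    (hg : g ∈ Γ) (hh : h ∈ Γ) (hne : ¬ (i = j ∧ g = h)) :
    GenericPair (g '' seg f i) (h '' seg f j) := by
  have := (G.generic i j (g⁻¹ * h) (Γ.mul_mem (Γ.inv_mem hg) hh)
    (fun H => hne ⟨H.1, inv_mul_eq_one.1 H.2⟩)).image g
  rwa [← Iso2.image_mul, mul_inv_cancel_left] at this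

lemma image_inter_image_nonempty_iff (g h : Iso2) (S T : Set Pt) :
    (g '' S ∩ h '' T).Nonempty ↔ (S ∩ (g⁻¹ * h : Iso2) '' T).Nonempty := by
  have : h '' T = g '' ((g⁻¹ * h : Iso2) '' T) := by
    rw [← Iso2.image_mul, mul_inv_cancel_left]
  rw [this, ← Set.image_inter g.injective, Set.image_nonempty]

lemma IsGenericCopy.image_inter_nonempty_iff (G : IsGenericCopy Γ e f) {i j : Fin n}
    {g h : Iso2} (hg : g ∈ Γ) (hh : h ∈ Γ) :
    (g '' seg e i ∩ h '' seg e j).Nonempty ↔ (g '' seg f i ∩ h '' seg f j).Nonempty := by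
  by_cases hij : i = j ∧ g = h
  · obtain ⟨rfl, rfl⟩ := hij
    simp only [Set.inter_self, Set.image_nonempty]
    exact ⟨fun _ => ⟨_, mem_seg f i false⟩, fun _ => ⟨_, mem_seg e i false⟩⟩
  · rw [image_inter_image_nonempty_iff, image_inter_image_nonempty_iff]
    exact G.inter i j _ (Γ.mul_mem (Γ.inv_mem hg) hh)
      (fun H => hij ⟨H.1, inv_mul_eq_one.1 H.2⟩)

lemma IsGenericCopy.isSeg_image (G : IsGenericCopy Γ e f) (i : Fin n) (g : Iso2) :
    IsSeg (g '' seg f i) :=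
  ⟨_, _, g.injective.ne (G.ne i), image_seg g i⟩

lemma IsGenericCopy.eq_of_image_eq (G : IsGenericCopy Γ e f) {i j : Fin n} {g h : Iso2}
    (hg : g ∈ Γ) (hh : h ∈ Γ) (H : g '' seg f i = h '' seg f j) : i = j ∧ g = h :=
  by_contra fun hne => not_genericPair_of_eq H (G.isSeg_image i g)
    (G.genericPair_image hg hh hne)

/-- The translates of a family in generic position form a generic symmetric contact system. -/
lemma IsGenericCopy.isGenSymmCS (G : IsGenericCopy Γ e f) :
    IsGenSymmCS Γ {S | ∃ i, ∃ g ∈ Γ, g '' seg f i = S} := by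
  refine ⟨⟨⟨?_, ?_⟩, ?_⟩, ?_, ?_, ?_⟩
  · rintro _ ⟨i, g, -, rfl⟩
    exact G.isSeg_image i g
  · rintro x _ ⟨i, g, hg, rfl⟩ _ ⟨j, h, hh, rfl⟩ h1 h2
    by_contra hne
    exact (G.genericPair_image hg hh fun H => hne (by rw [H.1, H.2])).1 x h1 h2
  · rintro x _ ⟨i, g, hg, rfl⟩ _ ⟨j, h, hh, rfl⟩ h1 h2
    by_contra hne
    exact (G.genericPair_image hg hh fun H => hne (by rw [H.1, H.2])).2 x h1 h2
  · rintro _ ⟨i, g, hg, rfl⟩ h hh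
    exact ⟨i, h * g, Γ.mul_mem hh hg, Iso2.image_mul h g _⟩
  · refine ⟨Set.range (seg f), Set.finite_range _, ?_, ?_⟩
    · rintro _ ⟨i, rfl⟩
      exact ⟨i, 1, Γ.one_mem, by simp⟩
    · rintro _ ⟨i, g, hg, rfl⟩
      exact ⟨_, ⟨i, rfl⟩, g, hg, rfl⟩
  · rintro _ ⟨i, g, hg, rfl⟩ x hx h hh hxx
    by_contra hne
    have hG := G.genericPair_image (i := i) (j := i) hg (Γ.mul_mem hh hg)
      fun H => hne (right_eq_mul.1 H.2)
    rw [Iso2.image_mul] at hG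
    have hx0 := hx
    rw [image_seg, ← insert_endpoints_openSegment] at hx0
    have hgne := g.injective.ne (G.ne i)
    have hE : IsEndpt x (g '' seg f i) → False := fun h1 =>
      hG.2 x h1 (by have := h1.image h; rwa [hxx] at this)
    rcases hx0 with hx0 | hx0 | hx0
    · exact hE ⟨_, _, hgne, image_seg g i, Or.inl hx0⟩
    · exact hE ⟨_, _, hgne, image_seg g i, Or.inr hx0⟩
    · have h1 : IsIntPt x (g '' seg f i) := ⟨_, _, hgne, image_seg g i, hx0⟩
      exact hG.1 x h1 (by have := h1.image h; rwa [hxx] at this)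

lemma hausdorffDist_image_seg_le {r : ℝ} {i : Fin n} (hr : 0 < r)
    (hd : ∀ b, dist (e i b) (f i b) < r) (g : Iso2) :
    Metric.hausdorffDist (g '' seg e i) (g '' seg f i) ≤ r := by
  refine Metric.hausdorffDist_le_of_mem_dist hr.le (fun x hx => ?_) fun x hx => ?_
  · obtain ⟨y, hy, h⟩ := exists_mem_image_seg_dist_lt hd g hx
    exact ⟨y, hy, h.le⟩
  · obtain ⟨y, hy, h⟩ := exists_mem_image_seg_dist_lt
      (fun b => by rw [dist_comm]; exact hd b) g hx
    exact ⟨y, hy, h.le⟩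

end Perturbation

/-- A `Γ`-invariant 2-contact system with finitely many orbits
satisfying (S4) and (S5) can be perturbed, by an arbitrarily small amount in
Hausdorff distance, to a generic `Γ`-symmetric contact system with the same
intersection pattern. -/
theorem stmt_5 (Γ : Subgroup Iso2) (hdisc : IsDiscreteSubgrp Γ)
    (L : Set (Set Pt)) (hL : Is2ContactSystem L)
    (hS1 : SatS1 Γ L) (hS2 : SatS2 Γ L) (hS4 : SatS4 Γ L)
    (hS5 : ∀ g ∈ Γ, g ≠ 1 → (∃ l ∈ L, ((⇑g) '' l ∩ l).Nonempty) →
      ¬ IsTranslation g)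
    {ε : ℝ} (hε : 0 < ε) :
    ∃ (L' : Set (Set Pt)) (φ : Set Pt → Set Pt),
      IsGenSymmCS Γ L' ∧ Set.BijOn φ L L' ∧
      (∀ l ∈ L, ∀ m ∈ L, ((l ∩ m).Nonempty ↔ (φ l ∩ φ m).Nonempty)) ∧
      (∀ l ∈ L, Metric.hausdorffDist l (φ l) < ε) := by
  obtain ⟨n, e, F, hmem, hsurj, hinj⟩ := exists_isFrame hdisc hL hS1 hS2 hS4 hS5
  obtain ⟨f, G, hdist⟩ := F.exists_isGenericCopy (half_pos hε)
  have hφ : ∀ l, ∃ l', ∀ i, ∀ g ∈ Γ, g '' seg e i = l → l' = g '' seg f i := by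
    intro l
    by_cases h : ∃ i, ∃ g ∈ Γ, g '' seg e i = l
    · obtain ⟨i, g, hg, rfl⟩ := h
      refine ⟨g '' seg f i, fun j h hh H => ?_⟩
      obtain ⟨rfl, rfl⟩ := hinj j i h hh g hg H
      rfl
    · exact ⟨l, fun i g hg H => absurd ⟨i, g, hg, H⟩ h⟩
  choose φ hφ using hφ
  have hφ' : ∀ i, ∀ g ∈ Γ, φ (g '' seg e i) = g '' seg f i := fun i g hg => hφ _ i g hg rfl
  refine ⟨_, φ, G.isGenSymmCS, ⟨?_, ?_, ?_⟩, ?_, ?_⟩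
  · intro l hl
    obtain ⟨i, g, hg, rfl⟩ := hsurj l hl
    exact ⟨i, g, hg, (hφ' i g hg).symm⟩
  · intro l hl m hm hlm
    obtain ⟨i, g, hg, rfl⟩ := hsurj l hl
    obtain ⟨j, h, hh, rfl⟩ := hsurj m hm
    rw [hφ' i g hg, hφ' j h hh] at hlm
    obtain ⟨rfl, rfl⟩ := G.eq_of_image_eq hg hh hlm
    rfl
  · rintro _ ⟨i, g, hg, rfl⟩
    exact ⟨_, hmem i g hg, hφ' i g hg⟩
  · intro l hl m hm
    obtain ⟨i, g, hg, rfl⟩ := hsurj l hl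
    obtain ⟨j, h, hh, rfl⟩ := hsurj m hm
    rw [hφ' i g hg, hφ' j h hh]
    exact G.image_inter_nonempty_iff hg hh
  · intro l hl
    obtain ⟨i, g, hg, rfl⟩ := hsurj l hl
    rw [hφ' i g hg]
    exact (hausdorffDist_image_seg_le (half_pos hε) (hdist i) g).trans_lt (half_lt_self hε)
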